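/- arXiv:1902.00992 — 2 statements merged into one kernel-verified Lean document; each statement's English description precedes it below -/
import Mathlib

section
/- On the probability space [0,1] with Lebesgue measure m, there exists a set K of m-integrable random variables such that: K is convex, K = −K, sup_{X∈K} E_m[|X|] < ∞; K is compact in the metric d(X,Y) = E_m[min(|X−Y|,1)] of convergence in measure; the relative topology of convergence in measure on K is locally convex at every point of K (for every X ∈ K and every ε > 0 there exist δ > 0 and a convex set C with {Z ∈ K : d(Z,X) < δ} ⊆ C ⊆ {Z ∈ K : d(Z,X) < ε}); and yet there is NO probability measure Q on [0,1] equivalent to Lebesgue measure such that for every sequence (X_n) in K and every X ∈ K, (X_n) converges to X in measure if and only if E_Q[|X_n − X|] → 0. -/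
open MeasureTheory Filter Set ProbabilityTheory

noncomputable section

namespace Paper

variable {Ω : Type*} [MeasurableSpace Ω]

/-- The metric `d(X,Y) = E_P[min(|X - Y|, 1)]` metrizing convergence in `P`-probability. -/
def probDist (P : Measure Ω) (X Y : Ω → ℝ) : ℝ :=
  ∫ ω, min |X ω - Y ω| 1 ∂P

/-- `Q` is a probability measure equivalent to `P` (mutually absolutely continuous). -/
def EquivProb (P Q : Measure Ω) : Prop :=
  IsProbabilityMeasure Q ∧ Q ≪ P ∧ P ≪ Q

/-- `K` is a set of `P`-integrable random variables bounded in `L¹(P)`. -/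
def BddL1 (P : Measure Ω) (K : Set (Ω → ℝ)) : Prop :=
  (∀ X ∈ K, Integrable X P) ∧ ∃ C : ℝ, ∀ X ∈ K, (∫ ω, |X ω| ∂P) ≤ C

/-- `K` is `Q`-uniformly integrable: all members are `Q`-integrable and
`sup_{X ∈ K} E_Q[|X| · 1_{|X| > c}] → 0` as `c → ∞`. -/
def UIset (Q : Measure Ω) (K : Set (Ω → ℝ)) : Prop :=
  (∀ X ∈ K, Integrable X Q) ∧
  ∀ ε : ℝ, 0 < ε → ∃ c : ℝ, ∀ X ∈ K, (∫ ω in {ω | c < |X ω|}, |X ω| ∂Q) < ε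

/-- The sequence `Xs` is Cauchy in `P`-probability. -/
def CauchyInProb (P : Measure Ω) (Xs : ℕ → Ω → ℝ) : Prop :=
  ∀ ε : ℝ, 0 < ε →
    Tendsto (fun p : ℕ × ℕ => P {ω | ε ≤ |Xs p.1 ω - Xs p.2 ω|}) atTop (nhds 0)

/-- The (sequential) closure of `K` in the topology of convergence in `P`-probability. -/
def probClosure (P : Measure Ω) (K : Set (Ω → ℝ)) : Set (Ω → ℝ) :=
  {X | ∃ Xs : ℕ → Ω → ℝ, (∀ n, Xs n ∈ K) ∧ TendstoInMeasure P Xs atTop X}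

/-- A set `W` of random variables is solid: if `X ∈ W` and `|Y| ≤ |X|` a.s. then `Y ∈ W`. -/
def SolidSet (P : Measure Ω) (W : Set (Ω → ℝ)) : Prop :=
  ∀ X ∈ W, ∀ Y : Ω → ℝ, AEStronglyMeasurable Y P →
    (∀ᵐ ω ∂P, |Y ω| ≤ |X ω|) → Y ∈ W

/-- The solid hull of a set `A` of random variables. -/
def solidHull (P : Measure Ω) (A : Set (Ω → ℝ)) : Set (Ω → ℝ) :=
  {Y | AEStronglyMeasurable Y P ∧ ∃ X ∈ A, ∀ᵐ ω ∂P, |Y ω| ≤ |X ω|}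

/-- The relative `L⁰(P)`-topology on `K` is uniformly locally convex-solid on `S`:
for every `ε > 0` there is a convex solid set `W` of integrable random variables contained in the
`ε`-ball around `0` such that, for each `X ∈ S`, `(X + W) ∩ K` contains a `d`-ball of `K`
around `X`. -/
def UnifLCS (P : Measure Ω) (K S : Set (Ω → ℝ)) : Prop :=
  ∀ ε : ℝ, 0 < ε → ∃ W : Set (Ω → ℝ),
    (∀ Z ∈ W, Integrable Z P) ∧ Convex ℝ W ∧ SolidSet P W ∧
    (∀ Z ∈ W, probDist P Z 0 < ε) ∧
    ∀ X ∈ S, ∃ δ : ℝ, 0 < δ ∧ ∀ Z ∈ K, probDist P Z X < δ → Z - X ∈ W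

/-- The `L⁰(Q)`- and `L¹(Q)`-topologies agree on `K`: a sequence in `K` converges in
`P`-probability to a member of `K` iff it converges in `L¹(Q)`-norm. -/
def TopAgree (P Q : Measure Ω) (K : Set (Ω → ℝ)) : Prop :=
  ∀ (Xs : ℕ → Ω → ℝ) (X : Ω → ℝ), (∀ n, Xs n ∈ K) → X ∈ K →
    (TendstoInMeasure P Xs atTop X ↔
      Tendsto (fun n => ∫⁻ ω, ENNReal.ofReal |Xs n ω - X ω| ∂Q) atTop (nhds 0))

/-- `W` is a forward convex combination of the sequence `Z`. -/
def IsFCC (Z : ℕ → Ω → ℝ) (W : ℕ → Ω → ℝ) : Prop :=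
  ∀ k, W k ∈ convexHull ℝ (Z '' {n | k ≤ n})

/-- The relative `L⁰(P)`-topology on `K` is locally convex at `X` (forward convex combination
formulation): every FCC of a sequence in `K` converging to `X` in probability also converges
to `X` in probability. -/
def LocConvexAt (P : Measure Ω) (K : Set (Ω → ℝ)) (X : Ω → ℝ) : Prop :=
  ∀ Xs : ℕ → Ω → ℝ, (∀ n, Xs n ∈ K) → TendstoInMeasure P Xs atTop X →
    ∀ W : ℕ → Ω → ℝ, IsFCC Xs W → TendstoInMeasure P W atTop X

/-- The set `L = {Σ_k a_k R_k : Σ_k |a_k| ≤ 1}` (with pointwise a.e. absolutely convergent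
series, which also converge in `L¹(P)`). -/
def Lset (R : ℕ → Ω → ℝ) : Set (Ω → ℝ) :=
  {G | ∃ a : ℕ → ℝ, Summable (fun k => |a k|) ∧ (∑' k, |a k|) ≤ 1 ∧
    G = fun ω => ∑' k, a k * R k ω}

/-- The standard Cauchy distribution on `ℝ`. -/
def cauchyLaw : Measure ℝ :=
  MeasureTheory.volume.withDensity (fun t => ENNReal.ofReal (1 / (Real.pi * (1 + t ^ 2))))

/-- Local convexity of the relative topology on `A ⊆ E` at a point `x ∈ A`, in a topological
vector space. -/
def LocConvexAtTVS {E : Type*} [AddCommGroup E] [Module ℝ E] [TopologicalSpace E]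
    (A : Set E) (x : E) : Prop :=
  ∀ V ∈ nhds (0 : E), ∃ U ∈ nhds (0 : E), ∃ C : Set E,
    Convex ℝ C ∧ ((fun u => x + u) '' U) ∩ A ⊆ C ∧ C ⊆ ((fun v => x + v) '' V) ∩ A

/-- The uniform law on `[-1, 1]`. -/
def unifLaw : Measure ℝ := (2⁻¹ : ENNReal) • volume.restrict (Icc (-1) 1)

instance : IsProbabilityMeasure unifLaw := by
  constructor
  simp only [unifLaw, Measure.smul_apply, Measure.restrict_apply_univ, Real.volume_Icc, smul_eq_mul]
  norm_num
  exact ENNReal.inv_mul_cancel (by simp) (by simp)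

lemma integral_unifLaw (h : ℝ → ℝ) : ∫ u, h u ∂unifLaw = 2⁻¹ * ∫ u in Icc (-1) 1, h u := by
  simp [unifLaw, integral_smul_measure]

lemma integral_unifLaw_eq_zero_of_odd {h : ℝ → ℝ} (hodd : ∀ u, h (-u) = -h u) :
    ∫ u, h u ∂unifLaw = 0 := by
  rw [integral_unifLaw, integral_Icc_eq_integral_Ioc,
    ← intervalIntegral.integral_of_le (by norm_num)]
  have h1 := intervalIntegral.integral_comp_neg (a := -1) (b := 1) h
  simp only [hodd, intervalIntegral.integral_neg, neg_neg] at h1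
  linarith

/-- The function `u ↦ s / u`, set to `0` on the interval `|u| < δ`. -/
def truncInv (s δ u : ℝ) : ℝ := if δ ≤ |u| then s / u else 0

section TruncInv

variable {s δ : ℝ}

lemma measurable_truncInv (s δ : ℝ) : Measurable (truncInv s δ) := by
  unfold truncInv
  exact Measurable.ite (measurableSet_le measurable_const (by fun_prop)) (by fun_prop) (by fun_prop)

lemma truncInv_neg (s δ u : ℝ) : truncInv s δ (-u) = -truncInv s δ u := by
  unfold truncInv
  split_ifs <;> simp_all [div_neg]

lemma abs_truncInv_le (hs : 0 < s) (hδ : 0 < δ) (u : ℝ) : |truncInv s δ u| ≤ s / δ := by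
  unfold truncInv
  split_ifs with h
  · rw [abs_div, abs_of_pos hs]
    gcongr
  · simp only [abs_zero]; positivity

lemma abs_truncInv_mul_le (hs : 0 < s) (u : ℝ) : |truncInv s δ u| * |u| ≤ s := by
  unfold truncInv
  split_ifs with h
  · rw [abs_div, abs_of_pos hs]
    rcases eq_or_ne u 0 with rfl | hu
    · simpa using hs.le
    · exact (div_mul_cancel₀ s (abs_ne_zero.2 hu)).le
  · simp only [abs_zero]; linarith

lemma integral_abs_truncInv (hs : 0 < s) (hδ : 0 < δ) (hδ1 : δ ≤ 1) :
    ∫ u, |truncInv s δ u| ∂unifLaw = -(s * Real.log δ) := by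
  have e : ∀ u : ℝ, (Icc (-1) 1).indicator (fun u => |truncInv s δ u|) u
      = (Icc δ 1).indicator (fun t => s * t⁻¹) |u| := by
    intro u
    simp only [indicator, mem_Icc, ← abs_le, truncInv]
    split_ifs <;> simp_all [abs_of_pos hs, div_eq_mul_inv]
  rw [integral_unifLaw, ← integral_indicator measurableSet_Icc]
  simp_rw [e]
  rw [integral_comp_abs (f := (Icc δ 1).indicator (fun t => s * t⁻¹)),
    setIntegral_indicator measurableSet_Icc,
    inter_eq_right.2 (show Icc δ 1 ⊆ Ioi 0 from fun x hx => hδ.trans_le hx.1), integral_Icc_eq_integral_Ioc,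
    ← intervalIntegral.integral_of_le hδ1, intervalIntegral.integral_const_mul,
    integral_inv_of_pos hδ one_pos]
  simp

lemma unifLaw_real_truncInv_gt_le (hs : 0 < s) {x : ℝ} (hx : 0 < x) :
    unifLaw.real {u | x < |truncInv s δ u|} ≤ s / x := by
  have hsub : {u | x < |truncInv s δ u|} ⊆ Icc (-(s / x)) (s / x) := by
    intro u hu
    rw [mem_Icc, ← abs_le, le_div_iff₀ hx]
    have := abs_truncInv_mul_le (δ := δ) hs u
    have hu' : x < |truncInv s δ u| := hu
    nlinarith [abs_nonneg u]
  have hle : unifLaw (Icc (-(s / x)) (s / x)) ≤ ENNReal.ofReal (s / x) := by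
    simp only [unifLaw, Measure.smul_apply, smul_eq_mul]
    refine (mul_le_mul_right (Measure.restrict_apply_le _ _) _).trans ?_
    rw [Real.volume_Icc, show s / x - -(s / x) = 2 * (s / x) by ring,
      ENNReal.ofReal_mul (by norm_num), ← mul_assoc]
    simp [ENNReal.inv_mul_cancel]
  exact ENNReal.toReal_le_of_le_ofReal (by positivity) ((measure_mono hsub).trans hle)

lemma integral_sq_truncInv_le (hs : 0 < s) {x : ℝ} (hx : 0 < x) :
    ∫ u, {u | |truncInv s δ u| ≤ x}.indicator (fun u => truncInv s δ u ^ 2) u ∂unifLaw ≤ s * x := by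
  have hp : 0 < s / x := by positivity
  have hpow_int : IntegrableOn (fun t : ℝ => s ^ 2 * t ^ (-2 : ℝ)) (Ioi (s / x)) :=
    (integrableOn_Ioi_rpow_of_lt (by norm_num) hp).const_mul _
  have e : ∀ u : ℝ, (Icc (-1) 1).indicator
      ({u | |truncInv s δ u| ≤ x}.indicator (fun u => truncInv s δ u ^ 2)) u
      = (Icc δ 1 ∩ Ici (s / x) ∩ Ioi 0).indicator (fun t : ℝ => s ^ 2 * t ^ (-2 : ℝ)) |u| := by
    intro u
    rcases eq_or_ne u 0 with rfl | hu
    · simp [indicator, truncInv]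
    have hu0 : 0 < |u| := abs_pos.2 hu
    by_cases h1 : |u| ≤ 1
    swap
    · rw [indicator_of_notMem (by rwa [mem_Icc, ← abs_le]),
        indicator_of_notMem (fun h => h1 h.1.1.2)]
    rw [indicator_of_mem (by rwa [mem_Icc, ← abs_le])]
    by_cases h2 : δ ≤ |u|
    swap
    · rw [indicator_of_notMem (s := Icc δ 1 ∩ Ici (s / x) ∩ Ioi 0) (fun h => h2 h.1.1.1)]
      simp [indicator, truncInv, h2]
    have hd : truncInv s δ u = s / u := if_pos h2
    have hiff : |truncInv s δ u| ≤ x ↔ s / x ≤ |u| := by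
      rw [hd, abs_div, abs_of_pos hs, div_le_iff₀ hu0, div_le_iff₀ hx, mul_comm]
    simp only [indicator, mem_ofPred_eq, hiff, mem_inter_iff, mem_Icc, mem_Ici, mem_Ioi, h1, h2, hu0,
      true_and, and_true]
    congr 1
    rw [hd, Real.rpow_neg hu0.le, div_pow, div_eq_mul_inv]
    norm_num
  have hm : MeasurableSet (Icc δ 1 ∩ Ici (s / x) ∩ Ioi 0) :=
    (measurableSet_Icc.inter measurableSet_Ici).inter measurableSet_Ioi
  rw [integral_unifLaw, ← integral_indicator measurableSet_Icc]
  simp_rw [e]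
  rw [integral_comp_abs (f := (Icc δ 1 ∩ Ici (s / x) ∩ Ioi 0).indicator _),
    setIntegral_indicator hm, inter_eq_right.2 inter_subset_right, ← mul_assoc]
  calc 2⁻¹ * 2 * ∫ t in Icc δ 1 ∩ Ici (s / x) ∩ Ioi 0, s ^ 2 * t ^ (-2 : ℝ)
      ≤ 2⁻¹ * 2 * ∫ t in Ici (s / x), s ^ 2 * t ^ (-2 : ℝ) := by
        refine mul_le_mul_of_nonneg_left (setIntegral_mono_set
          (by rwa [integrableOn_Ici_iff_integrableOn_Ioi]) ?_ ?_) (by norm_num)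
        · filter_upwards [ae_restrict_mem measurableSet_Ici] with t ht
          exact mul_nonneg (sq_nonneg _) (Real.rpow_nonneg (hp.le.trans ht) _)
        · exact (inter_subset_left.trans inter_subset_right).eventuallyLE
    _ = s * x := by
        rw [integral_Ici_eq_integral_Ioi, integral_const_mul,
          integral_Ioi_rpow_of_lt (by norm_num) hp]
        norm_num
        rw [Real.rpow_neg_one]
        field_simp

end TruncInv

lemma exists_iIndepFun_unifLaw :
    ∃ U : ℕ → ℝ → ℝ, (∀ k, Measurable (U k)) ∧
      (∀ k, (volume.restrict (Icc (0 : ℝ) 1)).map (U k) = unifLaw) ∧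
      iIndepFun U (volume.restrict (Icc (0 : ℝ) 1)) := by
  obtain ⟨f, hf, hmap⟩ := Measure.exists_measurable_map_eq (Measure.infinitePi fun _ : ℕ => unifLaw)
  have hpm : Measurable (projIcc (0 : ℝ) 1 zero_le_one) := continuous_projIcc.measurable
  have hp : (volume.restrict (Icc (0 : ℝ) 1)).map (projIcc (0 : ℝ) 1 zero_le_one) = volume := by
    have h1 : (volume : Measure (Icc (0 : ℝ) 1)).map Subtype.val = volume.restrict (Icc (0 : ℝ) 1) :=
      map_comap_subtype_coe measurableSet_Icc _
    rw [← h1, Measure.map_map hpm measurable_subtype_coe]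
    convert Measure.map_id
    ext x
    simp
  have hmapU : (volume.restrict (Icc (0 : ℝ) 1)).map
      (fun x k => f (projIcc (0 : ℝ) 1 zero_le_one x) k) = Measure.infinitePi fun _ => unifLaw := by
    rw [← hmap, ← hp, Measure.map_map hf hpm]
    rfl
  have hm : ∀ k, Measurable fun x => f (projIcc (0 : ℝ) 1 zero_le_one x) k :=
    fun k => (measurable_pi_apply k).comp (hf.comp hpm)
  have hlaw : ∀ k, (volume.restrict (Icc (0 : ℝ) 1)).map
      (fun x => f (projIcc (0 : ℝ) 1 zero_le_one x) k) = unifLaw := by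
    intro k
    rw [← Measure.infinitePi_map_eval (fun _ : ℕ => unifLaw) k, ← hmapU,
      Measure.map_map (measurable_pi_apply k) (measurable_pi_lambda _ hm)]
    rfl
  have : IsProbabilityMeasure (volume.restrict (Icc (0 : ℝ) 1)) := ⟨by simp⟩
  refine ⟨fun k x => f (projIcc (0 : ℝ) 1 zero_le_one x) k, hm, hlaw, ?_⟩
  rw [iIndepFun_iff_map_fun_eq_infinitePi_map hm, hmapU]
  simp_rw [hlaw]

/-- The scale `1 / log (k + 3)`. -/
def scale (k : ℕ) : ℝ := 1 / Real.log (k + 3)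

lemma log_add_three_pos (k : ℕ) : 0 < Real.log ((k : ℝ) + 3) :=
  Real.log_pos (by have := k.cast_nonneg (α := ℝ); linarith)

lemma scale_pos (k : ℕ) : 0 < scale k := one_div_pos.2 (log_add_three_pos k)

lemma scale_antitone : Antitone scale := by
  intro j k hjk
  have : (j : ℝ) ≤ k := by exact_mod_cast hjk
  exact one_div_le_one_div_of_le (log_add_three_pos j) (Real.log_le_log (by positivity) (by linarith))

lemma tendsto_scale : Tendsto scale atTop (nhds 0) := by
  have : Tendsto (fun k : ℕ => Real.log ((k : ℝ) + 3)) atTop atTop :=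
    Real.tendsto_log_atTop.comp (tendsto_atTop_add_const_right _ _ tendsto_natCast_atTop_atTop)
  exact tendsto_const_nhds.div_atTop this

/-- The odd function `u ↦ scale k / u` cut off at `|u| < 1 / (k + 3)`; its modulus has mean one
under `unifLaw`. -/
def heavy (k : ℕ) : ℝ → ℝ := truncInv (scale k) (1 / (k + 3))

lemma measurable_heavy (k : ℕ) : Measurable (heavy k) := measurable_truncInv _ _

lemma abs_heavy_le (k : ℕ) (u : ℝ) : |heavy k u| ≤ scale k * (k + 3) := by
  have := abs_truncInv_le (δ := 1 / ((k : ℝ) + 3)) (scale_pos k) (by positivity) u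
  simpa [heavy] using this

lemma integral_abs_heavy (k : ℕ) : ∫ u, |heavy k u| ∂unifLaw = 1 := by
  have h := integral_abs_truncInv (scale_pos k) (δ := 1 / ((k : ℝ) + 3)) (by positivity)
    (by rw [div_le_one (by positivity)]; have := k.cast_nonneg (α := ℝ); linarith)
  rw [heavy, h, one_div, Real.log_inv, scale, mul_neg, neg_neg,
    one_div_mul_cancel (log_add_three_pos k).ne']

lemma integral_heavy_sq_le (k : ℕ) : ∫ u, heavy k u ^ 2 ∂unifLaw ≤ scale k ^ 2 * (k + 3) := by
  have h := integral_sq_truncInv_le (δ := 1 / ((k : ℝ) + 3)) (scale_pos k)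
    (x := scale k * (k + 3)) (mul_pos (scale_pos k) (by positivity))
  rw [← mul_assoc, ← sq] at h
  convert h using 3 with u
  rw [indicator_of_mem]
  · rfl
  · exact abs_heavy_le k u

/-- `c * heavy k`, set to `0` where it exceeds `1` in modulus. -/
def cutHeavy (k : ℕ) (c u : ℝ) : ℝ := if |c * heavy k u| ≤ 1 then c * heavy k u else 0

lemma measurable_cutHeavy (k : ℕ) (c : ℝ) : Measurable (cutHeavy k c) := by
  have := measurable_heavy k
  unfold cutHeavy
  exact Measurable.ite (measurableSet_le (by fun_prop) measurable_const) (by fun_prop) (by fun_prop)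

lemma abs_cutHeavy_le (k : ℕ) (c u : ℝ) : |cutHeavy k c u| ≤ 1 := by
  unfold cutHeavy
  split_ifs with h
  · exact h
  · simp

lemma integral_cutHeavy (k : ℕ) (c : ℝ) : ∫ u, cutHeavy k c u ∂unifLaw = 0 := by
  refine integral_unifLaw_eq_zero_of_odd fun u => ?_
  have h : heavy k (-u) = -heavy k u := truncInv_neg _ _ u
  unfold cutHeavy
  rw [h, mul_neg, abs_neg]
  split_ifs <;> simp

lemma integral_cutHeavy_sq_le (k : ℕ) (c : ℝ) :
    ∫ u, cutHeavy k c u ^ 2 ∂unifLaw ≤ |c| * scale k := by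
  rcases eq_or_ne c 0 with rfl | hc
  · simp [cutHeavy]
  have hc' : 0 < |c| := abs_pos.2 hc
  have h := integral_sq_truncInv_le (δ := 1 / ((k : ℝ) + 3)) (scale_pos k) (x := 1 / |c|)
    (by positivity)
  have e : ∀ u, cutHeavy k c u ^ 2 = c ^ 2 * {u | |heavy k u| ≤ 1 / |c|}.indicator
      (fun u => heavy k u ^ 2) u := by
    intro u
    have : |c * heavy k u| ≤ 1 ↔ |heavy k u| ≤ 1 / |c| := by
      rw [abs_mul, le_div_iff₀ hc', mul_comm]
    simp only [cutHeavy, indicator, mem_ofPred_eq, this]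
    split_ifs <;> simp [mul_pow]
  simp_rw [e]
  rw [integral_const_mul]
  calc _ ≤ c ^ 2 * (scale k * (1 / |c|)) := mul_le_mul_of_nonneg_left h (sq_nonneg c)
    _ = |c| * scale k := by rw [← sq_abs]; field_simp

lemma unifLaw_real_heavy_gt_le (k : ℕ) (c : ℝ) :
    unifLaw.real {u | 1 < |c * heavy k u|} ≤ |c| * scale k := by
  rcases eq_or_ne c 0 with rfl | hc
  · simp [not_lt.2 (zero_le_one (α := ℝ))]
  have hc' : 0 < |c| := abs_pos.2 hc
  have h := unifLaw_real_truncInv_gt_le (δ := 1 / ((k : ℝ) + 3)) (scale_pos k) (x := 1 / |c|)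
    (by positivity)
  convert h using 1
  · congr 1
    ext u
    simp only [mem_ofPred_eq]
    rw [abs_mul, div_lt_iff₀ hc', mul_comm]
    rfl
  · field_simp

section Independent

variable {P : Measure Ω} {U : ℕ → Ω → ℝ}

lemma integral_comp_unif (hU : ∀ k, Measurable (U k)) (hlaw : ∀ k, P.map (U k) = unifLaw) (k : ℕ)
    {h : ℝ → ℝ} (hh : Measurable h) : ∫ ω, h (U k ω) ∂P = ∫ u, h u ∂unifLaw := by
  rw [← hlaw k, integral_map (hU k).aemeasurable hh.aestronglyMeasurable]

lemma probDist_sum_heavy_le [IsProbabilityMeasure P] (hU : ∀ k, Measurable (U k))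
    (hlaw : ∀ k, P.map (U k) = unifLaw) (hind : iIndepFun U P)
    (F : Finset ℕ) (c : ℕ → ℝ) {η t : ℝ} (ht : 0 < t)
    (hη : ∀ k ∈ F, scale k ≤ η) (hη0 : 0 ≤ η) (hc : ∑ k ∈ F, |c k| ≤ 2) :
    probDist P (fun ω => ∑ k ∈ F, c k * heavy k (U k ω)) 0 ≤ t + 2 * η / t + 2 * η := by
  set Y : ℕ → Ω → ℝ := fun k ω => cutHeavy k (c k) (U k ω) with hY
  have hYm : ∀ k, Measurable (Y k) := fun k => (measurable_cutHeavy k (c k)).comp (hU k)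
  have hYL : ∀ k, MemLp (Y k) 2 P := fun k =>
    MemLp.of_bound (hYm k).aestronglyMeasurable 1 (ae_of_all _ fun ω => abs_cutHeavy_le _ _ _)
  have hsumc : ∑ k ∈ F, |c k| * scale k ≤ 2 * η := by
    calc _ ≤ ∑ k ∈ F, |c k| * η :=
          Finset.sum_le_sum fun k hk => mul_le_mul_of_nonneg_left (hη k hk) (abs_nonneg _)
      _ ≤ 2 * η := by rw [← Finset.sum_mul]; exact mul_le_mul_of_nonneg_right hc hη0
  have hYsq : ∫ ω, (∑ k ∈ F, Y k ω) ^ 2 ∂P ≤ 2 * η := by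
    have hmean : ∀ k, ∫ ω, Y k ω ∂P = 0 := fun k => by
      rw [hY, integral_comp_unif hU hlaw k (measurable_cutHeavy k (c k)), integral_cutHeavy]
    have hvar := IndepFun.variance_sum (s := F) (fun k _ => hYL k) (fun i _ j _ hij =>
      (hind.indepFun hij).comp (measurable_cutHeavy i (c i)) (measurable_cutHeavy j (c j)))
    rw [variance_of_integral_eq_zero (Finset.aemeasurable_sum _ fun k _ => (hYm k).aemeasurable)
      (by
        simp only [Finset.sum_apply]
        rw [integral_finsetSum _ fun k _ => (hYL k).integrable (by norm_num)]
        simp [hmean])] at hvar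
    simp only [Finset.sum_apply] at hvar
    rw [hvar]
    refine (Finset.sum_le_sum fun k _ => ?_).trans hsumc
    rw [variance_of_integral_eq_zero (hYm k).aemeasurable (hmean k),
      integral_comp_unif hU hlaw k ((measurable_cutHeavy k (c k)).pow_const 2)]
    exact integral_cutHeavy_sq_le k (c k)
  have hAm : ∀ k, MeasurableSet {ω | 1 < |c k * heavy k (U k ω)|} := fun k =>
    measurableSet_lt measurable_const
      (((measurable_heavy k).comp (hU k)).const_mul _).abs
  have hA : ∀ k, ∫ ω, {ω | 1 < |c k * heavy k (U k ω)|}.indicator (1 : Ω → ℝ) ω ∂P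
      ≤ |c k| * scale k := by
    intro k
    rw [integral_indicator_one (hAm k)]
    refine le_trans (le_of_eq ?_) (unifLaw_real_heavy_gt_le k (c k))
    rw [← hlaw k, map_measureReal_apply (hU k)
      (measurableSet_lt measurable_const ((measurable_heavy k).const_mul _).abs)]
    rfl
  have hsumL : MemLp (fun ω => ∑ k ∈ F, Y k ω) 2 P := memLp_finsetSum _ fun k _ => hYL k
  have hi1 : Integrable (fun ω => t + (∑ k ∈ F, Y k ω) ^ 2 / t) P :=
    (integrable_const t).add (hsumL.integrable_sq.div_const t)
  have hi3 : ∀ k ∈ F,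
      Integrable (fun ω => {ω | 1 < |c k * heavy k (U k ω)|}.indicator (1 : Ω → ℝ) ω) P :=
    fun k _ => (integrable_const (1 : ℝ)).indicator (hAm k)
  have hi2 : Integrable (fun ω => ∑ k ∈ F,
      {ω | 1 < |c k * heavy k (U k ω)|}.indicator (1 : Ω → ℝ) ω) P :=
    integrable_finsetSum _ hi3
  calc probDist P (fun ω => ∑ k ∈ F, c k * heavy k (U k ω)) 0
      ≤ ∫ ω, ((t + (∑ k ∈ F, Y k ω) ^ 2 / t) + ∑ k ∈ F,
          {ω | 1 < |c k * heavy k (U k ω)|}.indicator (1 : Ω → ℝ) ω) ∂P := by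
        refine integral_mono_of_nonneg (ae_of_all _ fun ω => le_min (abs_nonneg _) zero_le_one)
          (hi1.add hi2) (ae_of_all _ fun ω => ?_)
        have hnn : ∀ k ∈ F, 0 ≤ {ω | 1 < |c k * heavy k (U k ω)|}.indicator (1 : Ω → ℝ) ω :=
          fun k _ => indicator_nonneg (fun _ _ => zero_le_one) _
        have hq : 0 ≤ (∑ k ∈ F, Y k ω) ^ 2 / t := by positivity
        by_cases hall : ∀ k ∈ F, |c k * heavy k (U k ω)| ≤ 1
        · have hs : ∑ k ∈ F, c k * heavy k (U k ω) = ∑ k ∈ F, Y k ω :=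
            Finset.sum_congr rfl fun k hk => (if_pos (hall k hk)).symm
          have h1 : |∑ k ∈ F, Y k ω| ≤ t + (∑ k ∈ F, Y k ω) ^ 2 / t := by
            rw [← sq_abs, ← sub_nonneg]
            have : t + |∑ k ∈ F, Y k ω| ^ 2 / t - |∑ k ∈ F, Y k ω|
              = ((t - |∑ k ∈ F, Y k ω|) ^ 2 + t * |∑ k ∈ F, Y k ω|) / t := by field_simp; ring
            rw [this]; positivity
          simp only [Pi.zero_apply, sub_zero, hs]
          exact (min_le_left _ _).trans (h1.trans (le_add_of_nonneg_right (Finset.sum_nonneg hnn)))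
        · push Not at hall
          obtain ⟨k, hk, hlt⟩ := hall
          have h1 := Finset.single_le_sum hnn hk
          rw [indicator_of_mem (by exact hlt)] at h1
          refine (min_le_right _ _).trans ?_
          simp only [Pi.one_apply] at h1
          linarith
    _ ≤ t + 2 * η / t + 2 * η := by
        rw [integral_add hi1 hi2, integral_add (integrable_const t) (hsumL.integrable_sq.div_const t),
          integral_div, integral_finsetSum _ hi3]
        simp only [integral_const, probReal_univ, one_smul]
        have := (Finset.sum_le_sum fun k (_ : k ∈ F) => hA k).trans hsumc
        gcongr

lemma tendstoInMeasure_average_abs_heavy [IsProbabilityMeasure P]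
    (hU : ∀ k, Measurable (U k)) (hlaw : ∀ k, P.map (U k) = unifLaw) (hind : iIndepFun U P) :
    TendstoInMeasure P
      (fun (n : ℕ) ω => (n : ℝ)⁻¹ * ∑ k ∈ Finset.Ico n (2 * n), |heavy k (U k ω)|) atTop
      fun _ => 1 := by
  have habs : ∀ k, Measurable fun u => |heavy k u| := fun k => (measurable_heavy k).abs
  have hXm : ∀ k, Measurable fun ω => |heavy k (U k ω)| := fun k => (habs k).comp (hU k)
  have hXL : ∀ k, MemLp (fun ω => |heavy k (U k ω)|) 2 P := fun k =>
    MemLp.of_bound (hXm k).aestronglyMeasurable (scale k * (k + 3))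
      (ae_of_all _ fun ω => by rw [Real.norm_eq_abs, abs_abs]; exact abs_heavy_le _ _)
  have hSL : ∀ n : ℕ, MemLp (fun ω => (n : ℝ)⁻¹ * ∑ k ∈ Finset.Ico n (2 * n), |heavy k (U k ω)|)
      2 P := fun n => (memLp_finsetSum _ fun k _ => hXL k).const_mul _
  have hmean : ∀ n : ℕ, 0 < n →
      ∫ ω, (n : ℝ)⁻¹ * ∑ k ∈ Finset.Ico n (2 * n), |heavy k (U k ω)| ∂P = 1 := by
    intro n hn
    rw [integral_const_mul, integral_finsetSum _ fun k _ => (hXL k).integrable (by norm_num)]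
    simp_rw [fun k => integral_comp_unif hU hlaw k (habs k), integral_abs_heavy]
    have : (n : ℝ) ≠ 0 := by positivity
    simp [show 2 * n - n = n by omega, this]
  have hvar : ∀ n : ℕ, 0 < n →
      Var[fun ω => (n : ℝ)⁻¹ * ∑ k ∈ Finset.Ico n (2 * n), |heavy k (U k ω)|; P]
        ≤ 5 * scale n ^ 2 := by
    intro n hn
    have hn1 : (1 : ℝ) ≤ n := by exact_mod_cast hn
    have hvs := IndepFun.variance_sum (s := Finset.Ico n (2 * n)) (fun k _ => hXL k)
      (fun i _ j _ hij => (hind.indepFun hij).comp (habs i) (habs j))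
    have hle : ∀ k ∈ Finset.Ico n (2 * n), Var[fun ω => |heavy k (U k ω)|; P]
        ≤ scale n ^ 2 * (5 * n) := by
      intro k hk
      rw [Finset.mem_Ico] at hk
      refine (variance_le_expectation_sq (hXm k).aestronglyMeasurable).trans ?_
      have h1 := integral_comp_unif hU hlaw k ((measurable_heavy k).pow_const 2)
      simp only [Pi.pow_apply, sq_abs]
      rw [h1]
      refine (integral_heavy_sq_le k).trans ?_
      have hk2 : (k : ℝ) ≤ 2 * n := by exact_mod_cast hk.2.le
      have := scale_antitone hk.1
      have := scale_pos k
      gcongr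
      linarith
    have hsum := Finset.sum_le_sum hle
    rw [← hvs] at hsum
    rw [variance_const_mul]
    have heq : (fun ω => ∑ k ∈ Finset.Ico n (2 * n), |heavy k (U k ω)|)
        = ∑ k ∈ Finset.Ico n (2 * n), fun ω => |heavy k (U k ω)| := by
      ext ω; simp
    rw [heq]
    calc _ ≤ ((n : ℝ)⁻¹) ^ 2 * ∑ k ∈ Finset.Ico n (2 * n), scale n ^ 2 * (5 * n) := by gcongr
      _ = 5 * scale n ^ 2 := by
        simp only [Finset.sum_const, Nat.card_Ico, nsmul_eq_mul, show 2 * n - n = n by omega]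
        field_simp
  rw [tendstoInMeasure_iff_norm]
  intro ε hε
  have hlim : Tendsto (fun n => ENNReal.ofReal (5 * scale n ^ 2 / ε ^ 2)) atTop (nhds 0) := by
    have : Tendsto (fun n => 5 * scale n ^ 2 / ε ^ 2) atTop (nhds (5 * 0 ^ 2 / ε ^ 2)) :=
      ((tendsto_scale.pow 2).const_mul 5).div_const _
    simpa using ENNReal.tendsto_ofReal this
  refine tendsto_of_tendsto_of_tendsto_of_le_of_le' tendsto_const_nhds hlim
    (Eventually.of_forall fun _ => zero_le) ?_
  filter_upwards [eventually_gt_atTop 0] with n hn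
  have h := meas_ge_le_variance_div_sq (hSL n) hε
  rw [hmean n hn] at h
  exact h.trans (ENNReal.ofReal_le_ofReal (by have := hvar n hn; gcongr))

end Independent

section ProbDist

variable {P : Measure Ω} {X Y Z : Ω → ℝ}

lemma probDist_nonneg : 0 ≤ probDist P X Y :=
  integral_nonneg fun _ => le_min (abs_nonneg _) zero_le_one

lemma probDist_comm : probDist P X Y = probDist P Y X := by
  simp only [probDist, abs_sub_comm]

lemma probDist_congr {X' Y' : Ω → ℝ} (hX : X =ᵐ[P] X') (hY : Y =ᵐ[P] Y') :
    probDist P X Y = probDist P X' Y' := by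
  refine integral_congr_ae ?_
  filter_upwards [hX, hY] with ω h1 h2
  rw [h1, h2]

lemma integrable_min_abs_sub [IsFiniteMeasure P] (hX : AEStronglyMeasurable X P)
    (hY : AEStronglyMeasurable Y P) : Integrable (fun ω => min |X ω - Y ω| 1) P := by
  refine Integrable.of_bound ((hX.sub hY).norm.inf aestronglyMeasurable_const) 1
    (ae_of_all _ fun ω => ?_)
  rw [Real.norm_of_nonneg (le_min (abs_nonneg _) zero_le_one)]
  exact min_le_right _ _

lemma probDist_triangle [IsFiniteMeasure P] (hX : AEStronglyMeasurable X P)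
    (hY : AEStronglyMeasurable Y P) (hZ : AEStronglyMeasurable Z P) :
    probDist P X Z ≤ probDist P X Y + probDist P Y Z := by
  have h1 := integrable_min_abs_sub hX hY
  have h2 := integrable_min_abs_sub hY hZ
  rw [probDist, probDist, probDist, ← integral_add h1 h2]
  refine integral_mono (integrable_min_abs_sub hX hZ) (h1.add h2) fun ω => ?_
  have h3 := abs_sub_le (X ω) (Y ω) (Z ω)
  have h4 := abs_nonneg (X ω - Y ω)
  have h5 := abs_nonneg (Y ω - Z ω)
  simp only [min_def]
  split_ifs <;> linarith

lemma ae_eq_of_probDist_eq_zero [IsFiniteMeasure P] (hX : AEStronglyMeasurable X P)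
    (hY : AEStronglyMeasurable Y P) (h : probDist P X Y = 0) : X =ᵐ[P] Y := by
  rw [probDist, integral_eq_zero_iff_of_nonneg (fun _ => le_min (abs_nonneg _) zero_le_one)
    (integrable_min_abs_sub hX hY)] at h
  filter_upwards [h] with ω hω
  simp only [Pi.zero_apply, min_def] at hω
  split_ifs at hω
  · exact sub_eq_zero.1 (abs_eq_zero.1 hω)
  · norm_num at hω

lemma tendstoInMeasure_of_tendsto_probDist [IsFiniteMeasure P] {Xs : ℕ → Ω → ℝ}
    (hXs : ∀ n, AEStronglyMeasurable (Xs n) P) (hX : AEStronglyMeasurable X P)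
    (h : Tendsto (fun n => probDist P (Xs n) X) atTop (nhds 0)) : TendstoInMeasure P Xs atTop X := by
  rw [tendstoInMeasure_iff_norm]
  intro ε hε
  have hm : 0 < min ε 1 := lt_min hε one_pos
  have hle : ∀ n, P {ω | ε ≤ ‖Xs n ω - X ω‖} ≤ ENNReal.ofReal (probDist P (Xs n) X / min ε 1) := by
    intro n
    have h1 := mul_meas_ge_le_integral_of_nonneg (μ := P) (f := fun ω => min |Xs n ω - X ω| 1)
      (ae_of_all _ fun _ => le_min (abs_nonneg _) zero_le_one)
      (integrable_min_abs_sub (hXs n) hX) (min ε 1)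
    have hsub : {ω | ε ≤ ‖Xs n ω - X ω‖} ⊆ {ω | min ε 1 ≤ min |Xs n ω - X ω| 1} :=
      fun ω (hω : ε ≤ |Xs n ω - X ω|) =>
        show min ε 1 ≤ min |Xs n ω - X ω| 1 from min_le_min_right 1 hω
    refine (measure_mono hsub).trans ?_
    rw [ENNReal.le_ofReal_iff_toReal_le (measure_ne_top _ _) (div_nonneg probDist_nonneg hm.le),
      le_div_iff₀ hm, mul_comm]
    exact h1
  refine tendsto_of_tendsto_of_tendsto_of_le_of_le tendsto_const_nhds ?_ (fun _ => zero_le) hle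
  simpa using ENNReal.tendsto_ofReal (h.div_const (min ε 1))

end ProbDist

section CoefBall

/-- The closed unit ball of `ℓ¹`, as a set of real sequences. -/
def coefBall : Set (ℕ → ℝ) := {a | ∀ n, ∑ k ∈ Finset.range n, |a k| ≤ 1}

variable {a b : ℕ → ℝ}

lemma summable_abs_of_mem_coefBall (ha : a ∈ coefBall) : Summable fun k => |a k| :=
  summable_of_sum_range_le (fun _ => abs_nonneg _) ha

lemma sum_abs_le_of_mem_coefBall (ha : a ∈ coefBall) (F : Finset ℕ) : ∑ k ∈ F, |a k| ≤ 1 :=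
  ((summable_abs_of_mem_coefBall ha).sum_le_tsum F fun _ _ => abs_nonneg _).trans
    (Real.tsum_le_of_sum_range_le (fun _ => abs_nonneg _) ha)

lemma convex_coefBall : Convex ℝ coefBall := by
  intro a ha b hb s t hs ht hst n
  calc ∑ k ∈ Finset.range n, |(s • a + t • b) k|
      ≤ ∑ k ∈ Finset.range n, (s * |a k| + t * |b k|) := by
        refine Finset.sum_le_sum fun k _ => ?_
        refine (abs_add_le _ _).trans (le_of_eq ?_)
        simp [abs_mul, abs_of_nonneg hs, abs_of_nonneg ht]
    _ = s * ∑ k ∈ Finset.range n, |a k| + t * ∑ k ∈ Finset.range n, |b k| := by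
        rw [Finset.sum_add_distrib, Finset.mul_sum, Finset.mul_sum]
    _ ≤ s * 1 + t * 1 := by gcongr <;> apply_assumption
    _ = 1 := by linarith

lemma isCompact_coefBall : IsCompact coefBall := by
  refine (isCompact_univ_pi fun _ : ℕ => isCompact_Icc (a := (-1 : ℝ)) (b := 1)).of_isClosed_subset
    ?_ ?_
  · have : coefBall = ⋂ n : ℕ, {a : ℕ → ℝ | ∑ k ∈ Finset.range n, |a k| ≤ 1} := by
      ext a; simp [coefBall]
    rw [this]
    exact isClosed_iInter fun n => isClosed_le (by fun_prop) continuous_const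
  · intro a ha k _
    rw [mem_Icc, ← abs_le]
    simpa using sum_abs_le_of_mem_coefBall ha {k}

lemma neg_mem_coefBall (ha : a ∈ coefBall) : -a ∈ coefBall := by
  intro n
  simpa using ha n

lemma zero_mem_coefBall : (0 : ℕ → ℝ) ∈ coefBall := by
  intro n
  simp

lemma single_mem_coefBall (k : ℕ) : Pi.single k (1 : ℝ) ∈ coefBall := by
  intro n
  simp only [Pi.single_apply, apply_ite abs, abs_one, abs_zero, Finset.sum_ite_eq']
  split_ifs <;> simp

end CoefBall

section Combination

variable {P : Measure Ω} {r : ℕ → Lp ℝ 1 P} {a b : ℕ → ℝ}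

/-- The `L¹`-convergent series `∑ aₖ rₖ`. -/
def combination (r : ℕ → Lp ℝ 1 P) (a : ℕ → ℝ) : Lp ℝ 1 P := ∑' k, a k • r k

/-- The random variables almost surely equal to `∑ aₖ rₖ` for some `∑ |aₖ| ≤ 1`. -/
def combinationSet (r : ℕ → Lp ℝ 1 P) : Set (Ω → ℝ) :=
  {X | ∃ a ∈ coefBall, X =ᵐ[P] combination r a}

lemma norm_smul_le_abs (hr : ∀ k, ‖r k‖ ≤ 1) (a : ℕ → ℝ) (k : ℕ) : ‖a k • r k‖ ≤ |a k| := by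
  rw [norm_smul, Real.norm_eq_abs]
  exact mul_le_of_le_one_right (abs_nonneg _) (hr k)

lemma hasSum_combination (hr : ∀ k, ‖r k‖ ≤ 1) (ha : a ∈ coefBall) :
    HasSum (fun k => a k • r k) (combination r a) :=
  (Summable.of_norm_bounded (summable_abs_of_mem_coefBall ha) (norm_smul_le_abs hr a)).hasSum

lemma norm_combination_le (hr : ∀ k, ‖r k‖ ≤ 1) (ha : a ∈ coefBall) : ‖combination r a‖ ≤ 1 :=
  (tsum_of_norm_bounded (summable_abs_of_mem_coefBall ha).hasSum (norm_smul_le_abs hr a)).trans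
    (Real.tsum_le_of_sum_range_le (fun _ => abs_nonneg _) ha)

lemma combination_convex_comb (hr : ∀ k, ‖r k‖ ≤ 1) (ha : a ∈ coefBall) (hb : b ∈ coefBall)
    (s t : ℝ) :
    combination r (s • a + t • b) = s • combination r a + t • combination r b := by
  refine HasSum.tsum_eq ?_
  convert ((hasSum_combination hr ha).const_smul s).add
    ((hasSum_combination hr hb).const_smul t) using 2 with k
  simp [add_smul, mul_smul]

lemma combination_neg : combination r (-a) = -combination r a := by
  simp only [combination, Pi.neg_apply, neg_smul, tsum_neg]

lemma combination_single (k : ℕ) : combination r (Pi.single k 1) = r k := by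
  rw [combination, tsum_eq_single k]
  · simp
  · intro j hj
    simp [hj]

lemma combination_zero : combination r 0 = 0 := by simp [combination]

lemma integrable_of_mem_combinationSet {X : Ω → ℝ} (hX : X ∈ combinationSet r) :
    Integrable X P := by
  obtain ⟨a, -, h⟩ := hX
  exact (L1.integrable_coeFn _).congr h.symm

lemma integral_abs_le_of_mem_combinationSet (hr : ∀ k, ‖r k‖ ≤ 1) {X : Ω → ℝ}
    (hX : X ∈ combinationSet r) : ∫ ω, |X ω| ∂P ≤ 1 := by
  obtain ⟨a, ha, h⟩ := hX
  refine le_trans (le_of_eq ?_) (norm_combination_le hr ha)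
  rw [L1.norm_eq_integral_norm]
  refine integral_congr_ae ?_
  filter_upwards [h] with ω hω
  rw [hω, Real.norm_eq_abs]

lemma ae_eq_convex_comb (hr : ∀ k, ‖r k‖ ≤ 1) (ha : a ∈ coefBall) (hb : b ∈ coefBall)
    {X Y : Ω → ℝ} (hX : X =ᵐ[P] combination r a) (hY : Y =ᵐ[P] combination r b) (s t : ℝ) :
    s • X + t • Y =ᵐ[P] combination r (s • a + t • b) := by
  rw [combination_convex_comb hr ha hb]
  filter_upwards [hX, hY, Lp.coeFn_add (s • combination r a) (t • combination r b),
    Lp.coeFn_smul s (combination r a), Lp.coeFn_smul t (combination r b)] with ω h1 h2 h3 h4 h5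
  rw [h3, Pi.add_apply, Pi.add_apply, h4, h5, Pi.smul_apply, Pi.smul_apply, h1, h2]
  rfl

lemma convex_combinationSet (hr : ∀ k, ‖r k‖ ≤ 1) : Convex ℝ (combinationSet r) := by
  rintro X ⟨a, ha, hX⟩ Y ⟨b, hb, hY⟩ s t hs ht hst
  exact ⟨_, convex_coefBall ha hb hs ht hst, ae_eq_convex_comb hr ha hb hX hY s t⟩

lemma neg_mem_combinationSet {X : Ω → ℝ} (hX : X ∈ combinationSet r) : -X ∈ combinationSet r := by
  obtain ⟨a, ha, h⟩ := hX
  refine ⟨-a, neg_mem_coefBall ha, ?_⟩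
  rw [combination_neg]
  exact h.neg.trans (Lp.coeFn_neg _).symm

lemma neg_combinationSet : combinationSet r = -combinationSet r := by
  ext X
  rw [Set.mem_neg]
  exact ⟨neg_mem_combinationSet, fun h => by simpa using neg_mem_combinationSet h⟩

lemma probDist_coe_sub (f g : Lp ℝ 1 P) :
    probDist P f g = probDist P (f - g : Lp ℝ 1 P) 0 := by
  refine integral_congr_ae ?_
  filter_upwards [Lp.coeFn_sub f g] with ω h
  rw [h, Pi.sub_apply, Pi.zero_apply, sub_zero]

/-- Finite combinations of far-out members of `r`, with coefficients bounded in `ℓ¹`, are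
uniformly small in probability. -/
def UnifSmallTails (r : ℕ → Lp ℝ 1 P) : Prop :=
  ∀ ε : ℝ, 0 < ε → ∃ N, ∀ F : Finset ℕ, (∀ k ∈ F, N ≤ k) → ∀ c : ℕ → ℝ, ∑ k ∈ F, |c k| ≤ 2 →
    probDist P (∑ k ∈ F, c k • r k : Lp ℝ 1 P) 0 ≤ ε

variable [IsProbabilityMeasure P]

lemma probDist_coe_le_norm (f : Lp ℝ 1 P) : probDist P f 0 ≤ ‖f‖ := by
  rw [L1.norm_eq_integral_norm]
  refine integral_mono (integrable_min_abs_sub (Lp.aestronglyMeasurable f)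
    aestronglyMeasurable_const) (L1.integrable_coeFn f).norm fun ω => ?_
  simp

lemma probDist_coe_add_le (f g : Lp ℝ 1 P) :
    probDist P (f + g : Lp ℝ 1 P) 0 ≤ probDist P f 0 + probDist P g 0 := by
  have h := probDist_triangle (Lp.aestronglyMeasurable (f + g)) (Lp.aestronglyMeasurable g)
    (aestronglyMeasurable_const (b := (0 : ℝ)))
  rw [probDist_coe_sub, add_sub_cancel_right] at h
  exact h

lemma continuous_probDist_coe :
    Continuous fun f : Lp ℝ 1 P => probDist P f 0 := by
  have h : ∀ f g : Lp ℝ 1 P, probDist P f 0 - probDist P g 0 ≤ ‖f - g‖ := by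
    intro f g
    have h1 := probDist_coe_add_le (f - g) g
    rw [sub_add_cancel] at h1
    linarith [probDist_coe_le_norm (f - g)]
  refine (LipschitzWith.of_dist_le_mul (K := 1) fun f g => ?_).continuous
  rw [Real.dist_eq, dist_eq_norm, NNReal.coe_one, one_mul, abs_le]
  have h1 := h f g
  have h2 := h g f
  rw [norm_sub_rev] at h2
  constructor <;> linarith

lemma probDist_combination_lt (hr : ∀ k, ‖r k‖ ≤ 1) (ht : UnifSmallTails r) {ε : ℝ} (hε : 0 < ε) :
    ∃ N : ℕ, ∃ η : ℝ, 0 < η ∧ ∀ a ∈ coefBall, ∀ b ∈ coefBall, (∀ k < N, |a k - b k| < η) →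
      probDist P (combination r a) (combination r b) < ε := by
  obtain ⟨N, hN⟩ := ht (ε / 3) (by positivity)
  refine ⟨N, ε / (3 * (N + 1)), by positivity, fun a ha b hb hab => ?_⟩
  set c : ℕ → ℝ := fun k => a k - b k with hc
  set S := combination r a - combination r b with hS
  have hsum : HasSum (fun k => c k • r k) S := by
    simpa only [hc, sub_smul] using (hasSum_combination hr ha).sub (hasSum_combination hr hb)
  set H := ∑ k ∈ Finset.range N, c k • r k with hH
  have hhead : ‖H‖ ≤ ε / 3 := by
    calc ‖H‖ ≤ ∑ k ∈ Finset.range N, ε / (3 * (N + 1)) :=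
          norm_sum_le_of_le _ fun k hk => (norm_smul_le_abs hr c k).trans
            (hab k (Finset.mem_range.1 hk)).le
      _ ≤ ε / 3 := by
          rw [Finset.sum_const, Finset.card_range, nsmul_eq_mul, ← mul_div_assoc,
            div_le_div_iff₀ (by positivity) (by positivity)]
          nlinarith
  have htail : probDist P (S - H : Lp ℝ 1 P) 0 ≤ ε / 3 := by
    have hlim := (continuous_probDist_coe (P := P)).continuousAt.tendsto.comp
      (hsum.tendsto_sum_nat.sub_const H)
    refine le_of_tendsto hlim ?_
    filter_upwards [eventually_ge_atTop N] with n hn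
    simp only [Function.comp_apply, hH]
    rw [← Finset.sum_Ico_eq_sub _ hn]
    refine hN _ (fun k hk => (Finset.mem_Ico.1 hk).1) c ?_
    calc ∑ k ∈ Finset.Ico N n, |c k| ≤ ∑ k ∈ Finset.Ico N n, (|a k| + |b k|) :=
          Finset.sum_le_sum fun k _ => abs_sub _ _
      _ ≤ 2 := by
          rw [Finset.sum_add_distrib]
          linarith [sum_abs_le_of_mem_coefBall ha (Finset.Ico N n),
            sum_abs_le_of_mem_coefBall hb (Finset.Ico N n)]
  rw [probDist_coe_sub, ← hS]
  have h1 := probDist_coe_add_le H (S - H)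
  rw [add_sub_cancel] at h1
  linarith [probDist_coe_le_norm H]

lemma tendsto_probDist_combination (hr : ∀ k, ‖r k‖ ≤ 1) (ht : UnifSmallTails r)
    {as : ℕ → ℕ → ℝ} (has : ∀ n, as n ∈ coefBall) (ha : a ∈ coefBall)
    (h : Tendsto as atTop (nhds a)) :
    Tendsto (fun n => probDist P (combination r (as n)) (combination r a)) atTop (nhds 0) := by
  rw [Metric.tendsto_atTop']
  intro ε hε
  obtain ⟨N, η, hη, hN⟩ := probDist_combination_lt hr ht hε
  have hev : ∀ᶠ n in atTop, ∀ k ∈ Finset.range N, |as n k - a k| < η := by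
    rw [Filter.eventually_all_finset]
    intro k _
    exact Metric.tendsto_nhds.1 (tendsto_pi_nhds.1 h k) η hη
  obtain ⟨n₀, hn₀⟩ := eventually_atTop.1 hev
  refine ⟨n₀, fun n hn => ?_⟩
  rw [Real.dist_0_eq_abs, abs_of_nonneg probDist_nonneg]
  exact hN _ (has n) _ ha fun k hk => hn₀ n hn.le k (Finset.mem_range.2 hk)

lemma exists_subseq_combinationSet (hr : ∀ k, ‖r k‖ ≤ 1) (ht : UnifSmallTails r)
    {Xs : ℕ → Ω → ℝ} {as : ℕ → ℕ → ℝ} (has : ∀ n, as n ∈ coefBall)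
    (hXs : ∀ n, Xs n =ᵐ[P] combination r (as n)) :
    ∃ φ : ℕ → ℕ, StrictMono φ ∧ ∃ a ∈ coefBall, Tendsto (as ∘ φ) atTop (nhds a) ∧
      Tendsto (fun j => probDist P (Xs (φ j)) (combination r a)) atTop (nhds 0) := by
  obtain ⟨a, ha, φ, hφ, hlim⟩ := isCompact_coefBall.tendsto_subseq has
  refine ⟨φ, hφ, a, ha, hlim, ?_⟩
  have h := tendsto_probDist_combination hr ht (fun n => has (φ n)) ha hlim
  refine h.congr fun j => probDist_congr (hXs (φ j)).symm EventuallyEq.rfl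

lemma exists_convex_nhds_combinationSet (hr : ∀ k, ‖r k‖ ≤ 1) (ht : UnifSmallTails r)
    {X : Ω → ℝ} (hX : X ∈ combinationSet r) {ε : ℝ} (hε : 0 < ε) :
    ∃ δ : ℝ, 0 < δ ∧ ∃ C : Set (Ω → ℝ), Convex ℝ C ∧
      {Z | Z ∈ combinationSet r ∧ probDist P Z X < δ} ⊆ C ∧
        C ⊆ {Z | Z ∈ combinationSet r ∧ probDist P Z X < ε} := by
  obtain ⟨N, η, hη, hN⟩ := probDist_combination_lt hr ht hε
  set C : Set (Ω → ℝ) := {Z | ∃ b ∈ coefBall, ∃ a ∈ coefBall, Z =ᵐ[P] combination r b ∧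
    X =ᵐ[P] combination r a ∧ ∀ k < N, |b k - a k| < η} with hC
  have hconv : Convex ℝ C := by
    rintro Z ⟨b, hb, a, ha, hZ, hXa, hab⟩ Z' ⟨b', hb', a', ha', hZ', hXa', hab'⟩ s t hs ht hst
    refine ⟨_, convex_coefBall hb hb' hs ht hst, _, convex_coefBall ha ha' hs ht hst,
      ae_eq_convex_comb hr hb hb' hZ hZ' s t, ?_, fun k hk => ?_⟩
    · have := ae_eq_convex_comb hr ha ha' hXa hXa' s t
      rwa [← add_smul, hst, one_smul] at this
    · have h := convex_ball (0 : ℝ) η (x := b k - a k) (y := b' k - a' k)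
        (by simpa using hab k hk) (by simpa using hab' k hk) hs ht hst
      rw [mem_ball_zero_iff, Real.norm_eq_abs] at h
      convert h using 2
      simp only [Pi.add_apply, Pi.smul_apply, smul_eq_mul]
      ring
  have hsub : C ⊆ {Z | Z ∈ combinationSet r ∧ probDist P Z X < ε} := by
    rintro Z ⟨b, hb, a, ha, hZ, hXa, hab⟩
    refine ⟨⟨b, hb, hZ⟩, ?_⟩
    rw [probDist_congr hZ hXa]
    exact hN b hb a ha hab
  suffices h : ∃ δ : ℝ, 0 < δ ∧ {Z | Z ∈ combinationSet r ∧ probDist P Z X < δ} ⊆ C by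
    obtain ⟨δ, hδ, hδC⟩ := h
    exact ⟨δ, hδ, C, hconv, hδC, hsub⟩
  by_contra! hcon
  have hseq : ∀ n : ℕ, ∃ Z, ∃ b ∈ coefBall, Z =ᵐ[P] combination r b ∧
      probDist P Z X < 1 / ((n : ℝ) + 1) ∧ Z ∉ C := by
    intro n
    obtain ⟨Z, ⟨⟨b, hb, hZ⟩, hd⟩, hZC⟩ := not_subset.1 (hcon (1 / ((n : ℝ) + 1)) (by positivity))
    exact ⟨Z, b, hb, hZ, hd, hZC⟩
  choose Z b hb hZ hd hZC using hseq
  obtain ⟨φ, hφ, a, ha, hlim, hdlim⟩ := exists_subseq_combinationSet hr ht hb hZ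
  have hXm := (integrable_of_mem_combinationSet hX).aestronglyMeasurable
  have hZm : ∀ n, AEStronglyMeasurable (Z n) P := fun n =>
    (integrable_of_mem_combinationSet ⟨b n, hb n, hZ n⟩).aestronglyMeasurable
  have hdX : Tendsto (fun j => probDist P (Z (φ j)) X) atTop (nhds 0) :=
    (squeeze_zero (fun _ => probDist_nonneg) (fun n => (hd n).le)
      tendsto_one_div_add_atTop_nhds_zero_nat).comp hφ.tendsto_atTop
  have hzero : probDist P X (combination r a) = 0 := by
    refine le_antisymm (ge_of_tendsto' (by simpa using hdX.add hdlim) fun j => ?_) probDist_nonneg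
    rw [probDist_comm (X := Z (φ j))]
    exact probDist_triangle hXm (hZm _) (Lp.aestronglyMeasurable _)
  have hXa := ae_eq_of_probDist_eq_zero hXm (Lp.aestronglyMeasurable _) hzero
  have hev : ∀ᶠ n in atTop, ∀ k ∈ Finset.range N, |b (φ n) k - a k| < η := by
    rw [Filter.eventually_all_finset]
    intro k _
    exact Metric.tendsto_nhds.1 (tendsto_pi_nhds.1 hlim k) η hη
  obtain ⟨n, hn⟩ := hev.exists
  exact hZC (φ n) ⟨_, hb _, a, ha, hZ _, hXa, fun k hk => hn k (Finset.mem_range.2 hk)⟩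

end Combination

lemma not_tendsto_lintegral_of_tendstoInMeasure_one {P Q : Measure Ω} [IsProbabilityMeasure Q]
    (hQP : Q ≪ P) {f : ℕ → Ω → ℝ} (hf : ∀ n, Measurable (f n))
    (h : TendstoInMeasure P f atTop fun _ => 1) :
    ¬ Tendsto (fun n => ∫⁻ ω, ENNReal.ofReal (f n ω) ∂Q) atTop (nhds 0) := by
  intro h0
  obtain ⟨φ, hφ, hae⟩ : ∃ φ : ℕ → ℕ, StrictMono φ ∧
      ∀ᵐ ω ∂P, Tendsto (fun n => f (φ n) ω) atTop (nhds 1) := h.exists_seq_tendsto_ae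
  have h1 : ∫⁻ ω, liminf (fun n => ENNReal.ofReal (f (φ n) ω)) atTop ∂Q = 1 := by
    have : ∀ᵐ ω ∂Q, liminf (fun n => ENNReal.ofReal (f (φ n) ω)) atTop = 1 := by
      filter_upwards [hQP.ae_le hae] with ω hω
      simpa using (ENNReal.tendsto_ofReal hω).liminf_eq
    rw [lintegral_congr_ae this]
    simp
  have h2 := lintegral_liminf_le (μ := Q) (u := atTop) (f := fun n ω => ENNReal.ofReal (f (φ n) ω))
    fun n => (hf (φ n)).ennreal_ofReal
  have h3 : Tendsto (fun n => ∫⁻ ω, ENNReal.ofReal (f (φ n) ω) ∂Q) atTop (nhds 0) :=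
    h0.comp hφ.tendsto_atTop
  rw [h1, h3.liminf_eq] at h2
  simp at h2

lemma tendsto_lintegral_average {Q : Measure Ω} {X : ℕ → Ω → ℝ} (hX : ∀ k, Measurable (X k))
    (h : Tendsto (fun k => ∫⁻ ω, ENNReal.ofReal |X k ω| ∂Q) atTop (nhds 0)) :
    Tendsto (fun n : ℕ => ∫⁻ ω, ENNReal.ofReal
      ((n : ℝ)⁻¹ * ∑ k ∈ Finset.Ico n (2 * n), |X k ω|) ∂Q) atTop (nhds 0) := by
  rw [ENNReal.tendsto_atTop_zero] at h ⊢
  intro ε hε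
  obtain ⟨N, hN⟩ := h ε hε
  refine ⟨N + 1, fun n hn => ?_⟩
  have hn0 : (0 : ℝ) < n := by exact_mod_cast (by omega : 0 < n)
  simp_rw [ENNReal.ofReal_mul (inv_nonneg.2 hn0.le),
    ENNReal.ofReal_sum_of_nonneg fun k _ => abs_nonneg _]
  rw [lintegral_const_mul _ (Finset.measurable_sum _ fun k _ => (hX k).abs.ennreal_ofReal),
    lintegral_finsetSum _ fun k _ => (hX k).abs.ennreal_ofReal]
  calc _ ≤ ENNReal.ofReal (n : ℝ)⁻¹ * ∑ k ∈ Finset.Ico n (2 * n), ε := by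
        gcongr with k hk
        rw [Finset.mem_Ico] at hk
        exact hN k (by omega)
    _ = ε := by
        rw [Finset.sum_const, Nat.card_Ico, show 2 * n - n = n by omega, nsmul_eq_mul, ← mul_assoc,
          ENNReal.ofReal_inv_of_pos hn0, ENNReal.ofReal_natCast,
          ENNReal.inv_mul_cancel (by simp; omega) (by simp), one_mul]

section HeavyL1

variable {P : Measure Ω} [IsProbabilityMeasure P] {U : ℕ → Ω → ℝ}

lemma integrable_heavy_comp (hU : ∀ k, Measurable (U k)) (k : ℕ) :
    Integrable (fun ω => heavy k (U k ω)) P :=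
  Integrable.of_bound ((measurable_heavy k).comp (hU k)).aestronglyMeasurable _
    (ae_of_all _ fun ω => abs_heavy_le k (U k ω))

lemma norm_toL1_heavy (hU : ∀ k, Measurable (U k)) (hlaw : ∀ k, P.map (U k) = unifLaw) (k : ℕ) :
    ‖(integrable_heavy_comp (P := P) hU k).toL1‖ = 1 := by
  rw [L1.norm_of_fun_eq_integral_norm]
  simp only [Real.norm_eq_abs]
  rw [integral_comp_unif hU hlaw k (measurable_heavy k).abs, integral_abs_heavy]

lemma coeFn_sum_smul_toL1_heavy (hU : ∀ k, Measurable (U k)) (F : Finset ℕ) (c : ℕ → ℝ) :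
    (∑ k ∈ F, c k • (integrable_heavy_comp (P := P) hU k).toL1 : Lp ℝ 1 P)
      =ᵐ[P] fun ω => ∑ k ∈ F, c k * heavy k (U k ω) := by
  induction F using Finset.induction_on with
  | empty =>
    simp only [Finset.sum_empty]
    exact Lp.coeFn_zero _ _ _
  | insert j F hj ih =>
    simp only [Finset.sum_insert hj]
    filter_upwards [Lp.coeFn_add (c j • (integrable_heavy_comp (P := P) hU j).toL1)
      (∑ k ∈ F, c k • (integrable_heavy_comp (P := P) hU k).toL1),
      Lp.coeFn_smul (c j) (integrable_heavy_comp (P := P) hU j).toL1,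
      (integrable_heavy_comp (P := P) hU j).coeFn_toL1, ih] with ω h1 h2 h3 h4
    rw [h1, Pi.add_apply, h2, Pi.smul_apply, h3, h4, smul_eq_mul]

lemma unifSmallTails_heavy (hU : ∀ k, Measurable (U k)) (hlaw : ∀ k, P.map (U k) = unifLaw)
    (hind : iIndepFun U P) :
    UnifSmallTails fun k => (integrable_heavy_comp (P := P) hU k).toL1 := by
  intro ε hε
  set η := min (ε ^ 2 / 18) (ε / 6) with hη
  have hη0 : 0 < η := lt_min (by positivity) (by positivity)
  obtain ⟨N, hN⟩ := (tendsto_scale.eventually (gt_mem_nhds hη0)).exists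
  refine ⟨N, fun F hF c hc => ?_⟩
  rw [probDist_congr (coeFn_sum_smul_toL1_heavy hU F c) EventuallyEq.rfl]
  refine (probDist_sum_heavy_le hU hlaw hind F c (t := ε / 3) (by positivity)
    (fun k hk => (scale_antitone (hF k hk)).trans hN.le) hη0.le hc).trans ?_
  have h1 : 2 * η / (ε / 3) ≤ ε / 3 := by
    rw [div_le_iff₀ (by positivity)]
    have := min_le_left (ε ^ 2 / 18) (ε / 6)
    nlinarith
  have := min_le_right (ε ^ 2 / 18) (ε / 6)
  linarith

end HeavyL1

/-- Theorem 1.4 (Example A): on `[0,1]` with Lebesgue measure there is a convex, circled,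
`L¹`-bounded set `K`, compact in the topology of convergence in measure, on which that
topology is locally convex, yet no probability measure equivalent to Lebesgue measure makes
the `L⁰(Q)`- and `L¹(Q)`-topologies agree on `K`. -/
theorem statement17 (P : Measure ℝ) (hP : P = MeasureTheory.volume.restrict (Set.Icc 0 1)) :
    ∃ K : Set (ℝ → ℝ),
      (∀ X ∈ K, Integrable X P) ∧ Convex ℝ K ∧ K = -K ∧
      (∃ C : ℝ, ∀ X ∈ K, (∫ ω, |X ω| ∂P) ≤ C) ∧
      (∀ Xs : ℕ → ℝ → ℝ, (∀ n, Xs n ∈ K) →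
        ∃ φ : ℕ → ℕ, StrictMono φ ∧ ∃ X ∈ K,
          Tendsto (fun j => probDist P (Xs (φ j)) X) atTop (nhds 0)) ∧
      (∀ X ∈ K, ∀ ε : ℝ, 0 < ε → ∃ δ : ℝ, 0 < δ ∧ ∃ C : Set (ℝ → ℝ),
        Convex ℝ C ∧ {Z | Z ∈ K ∧ probDist P Z X < δ} ⊆ C ∧
          C ⊆ {Z | Z ∈ K ∧ probDist P Z X < ε}) ∧
      ¬ (∃ Q : Measure ℝ, EquivProb P Q ∧ TopAgree P Q K) := by
  have hprob : IsProbabilityMeasure P := by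
    rw [hP]
    exact ⟨by simp⟩
  obtain ⟨U, hU, hlaw, hind⟩ := exists_iIndepFun_unifLaw
  rw [← hP] at hind
  simp only [← hP] at hlaw
  have hRm : ∀ k, Measurable fun ω => heavy k (U k ω) := fun k => (measurable_heavy k).comp (hU k)
  set r : ℕ → Lp ℝ 1 P := fun k => (integrable_heavy_comp (P := P) hU k).toL1 with hr_def
  have hr : ∀ k, ‖r k‖ ≤ 1 := fun k => (norm_toL1_heavy hU hlaw k).le
  have ht : UnifSmallTails r := unifSmallTails_heavy hU hlaw hind
  refine ⟨combinationSet r, fun X hX => integrable_of_mem_combinationSet hX,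
    convex_combinationSet hr, neg_combinationSet,
    ⟨1, fun X hX => integral_abs_le_of_mem_combinationSet hr hX⟩, ?_,
    fun X hX ε hε => exists_convex_nhds_combinationSet hr ht hX hε, ?_⟩
  · intro Xs hXs
    choose as has hXas using hXs
    obtain ⟨φ, hφ, a, ha, -, hlim⟩ := exists_subseq_combinationSet hr ht has hXas
    exact ⟨φ, hφ, combination r a, ⟨a, ha, EventuallyEq.rfl⟩, hlim⟩
  · rintro ⟨Q, ⟨hQ, hQP, -⟩, hagree⟩
    have hR : ∀ k, (fun ω => heavy k (U k ω)) ∈ combinationSet r := fun k =>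
      ⟨_, single_mem_coefBall k, by
        rw [combination_single]
        exact (integrable_heavy_comp (P := P) hU k).coeFn_toL1.symm⟩
    have h0 : (0 : ℝ → ℝ) ∈ combinationSet r :=
      ⟨0, zero_mem_coefBall, by rw [combination_zero]; exact (Lp.coeFn_zero _ _ _).symm⟩
    have hdist : Tendsto (fun k => probDist P (fun ω => heavy k (U k ω)) 0) atTop (nhds 0) := by
      rw [Metric.tendsto_atTop']
      intro ε hε
      obtain ⟨N, hN⟩ := ht (ε / 2) (by positivity)
      refine ⟨N, fun k hk => ?_⟩
      have h := hN {k} (by simpa using hk.le) 1 (by simp)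
      simp only [Finset.sum_singleton, Pi.one_apply, one_smul] at h
      rw [probDist_congr (integrable_heavy_comp (P := P) hU k).coeFn_toL1 EventuallyEq.rfl] at h
      rw [Real.dist_0_eq_abs, abs_of_nonneg probDist_nonneg]
      linarith
    have hL1 := (hagree _ 0 hR h0).1 (tendstoInMeasure_of_tendsto_probDist
      (fun k => (hRm k).aestronglyMeasurable) aestronglyMeasurable_const hdist)
    simp only [Pi.zero_apply, sub_zero] at hL1
    exact not_tendsto_lintegral_of_tendstoInMeasure_one hQP
      (fun n => (Finset.measurable_sum _ fun k _ => (hRm k).abs).const_mul _)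
      (tendstoInMeasure_average_abs_heavy hU hlaw hind) (tendsto_lintegral_average hRm hL1)

end Paper
end
end

section
/- There exist a nonatomic probability space (Ω,Σ,P) and a convex set K of nonnegative P-integrable random variables with sup_{X∈K} E_P[|X|] < ∞ such that: for every X ∈ K, every forward convex combination of any sequence in K that converges to X in P-probability also converges to X in P-probability (the L^0(P)-topology is locally convex on K); but there is NO probability measure Q equivalent to P such that for every sequence (X_n) in K and every X ∈ K, (X_n) converges to X in P-probability if and only if E_Q[|X_n − X|] → 0. -/
open MeasureTheory Filter Set ProbabilityTheory

noncomputable section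

namespace Paper

variable {Ω : Type*} [MeasurableSpace Ω]

section ForwardConvexCombination

variable {P : Measure Ω}

lemma convex_setOf_lintegral_enorm_sub_le {X : Ω → ℝ} (hX : Measurable X) (ε : ENNReal) :
    Convex ℝ {Y : Ω → ℝ | Measurable Y ∧ ∫⁻ z, ‖Y z - X z‖ₑ ∂P ≤ ε} := by
  rintro Y ⟨hY, hYle⟩ Y' ⟨hY', hYle'⟩ a b ha hb hab
  have hbound : ∀ Z : Ω → ℝ, ∫⁻ z, ‖Z z - X z‖ₑ ∂P ≤ ε → ∀ c : ℝ,
      ∫⁻ z, ‖c‖ₑ * ‖Z z - X z‖ₑ ∂P ≤ ‖c‖ₑ * ε := fun Z hZ c => by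
    rw [lintegral_const_mul' _ _ enorm_ne_top]
    gcongr
  refine ⟨(hY.const_smul a).add (hY'.const_smul b), ?_⟩
  calc ∫⁻ z, ‖(a • Y + b • Y') z - X z‖ₑ ∂P
      ≤ ∫⁻ z, (‖a‖ₑ * ‖Y z - X z‖ₑ + ‖b‖ₑ * ‖Y' z - X z‖ₑ) ∂P := by
        refine lintegral_mono fun z => ?_
        rw [← enorm_mul, ← enorm_mul]
        refine le_trans (le_of_eq ?_) (enorm_add_le _ _)
        congr 1
        simp only [Pi.add_apply, Pi.smul_apply, smul_eq_mul]
        linear_combination X z * hab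
    _ = ∫⁻ z, ‖a‖ₑ * ‖Y z - X z‖ₑ ∂P + ∫⁻ z, ‖b‖ₑ * ‖Y' z - X z‖ₑ ∂P :=
        lintegral_add_left' (by fun_prop) _
    _ ≤ ‖a‖ₑ * ε + ‖b‖ₑ * ε := add_le_add (hbound Y hYle a) (hbound Y' hYle' b)
    _ = ε := by
        rw [← add_mul, Real.enorm_of_nonneg ha, Real.enorm_of_nonneg hb,
          ← ENNReal.ofReal_add ha hb, hab, ENNReal.ofReal_one, one_mul]

/-- If `Xs` converges to `X` in `L¹` after restriction to sets of almost full measure, then so do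
its forward convex combinations, which therefore converge in measure. -/
lemma IsFCC.tendstoInMeasure {Xs W : ℕ → Ω → ℝ} {X : Ω → ℝ} (hW : IsFCC Xs W)
    (hXs : ∀ n, Measurable (Xs n)) (hX : Measurable X)
    (h : ∀ ε : ENNReal, 0 < ε → ∃ B, MeasurableSet B ∧ P Bᶜ ≤ ε ∧
      Tendsto (fun n => ∫⁻ z in B, ‖Xs n z - X z‖ₑ ∂P) atTop (nhds 0)) :
    TendstoInMeasure P W atTop X := by
  rw [tendstoInMeasure_iff_enorm]
  intro δ hδ hδ'
  rw [ENNReal.tendsto_nhds_zero]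
  intro ε hε
  obtain ⟨B, hB, hBc, hlim⟩ := h (ε / 2) (ENNReal.half_pos hε.ne')
  have hη : 0 < ε / 2 * δ := ENNReal.mul_pos (ENNReal.half_pos hε.ne').ne' hδ.ne'
  obtain ⟨k₀, hk₀⟩ := eventually_atTop.1 (ENNReal.tendsto_nhds_zero.1 hlim _ hη)
  filter_upwards [eventually_ge_atTop k₀] with k hk
  obtain ⟨hWm, hWle⟩ := convexHull_min (by
    rintro _ ⟨n, hn, rfl⟩
    exact ⟨hXs n, hk₀ n (hk.trans hn)⟩)
    (convex_setOf_lintegral_enorm_sub_le (P := P.restrict B) hX (ε / 2 * δ)) (hW k)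
  have hmarkov : P.restrict B {z | δ ≤ ‖W k z - X z‖ₑ} ≤ ε / 2 := by
    refine (meas_ge_le_lintegral_div (hWm.sub hX).enorm.aemeasurable hδ.ne' hδ').trans ?_
    exact ENNReal.div_le_of_le_mul hWle
  calc P {z | δ ≤ ‖W k z - X z‖ₑ}
      ≤ P ({z | δ ≤ ‖W k z - X z‖ₑ} ∩ B) + P Bᶜ := by
        refine (measure_mono ?_).trans (measure_union_le _ _)
        intro z hz
        by_cases hzB : z ∈ B
        · exact Or.inl ⟨hz, hzB⟩
        · exact Or.inr hzB
    _ ≤ ε / 2 + ε / 2 := by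
        refine add_le_add ?_ hBc
        rwa [← Measure.restrict_apply' hB]
    _ = ε := ENNReal.add_halves ε

end ForwardConvexCombination

section CoinSpace

/-- The fair coin. -/
def coin : Measure Bool := uniformOn univ

instance : IsProbabilityMeasure coin := isProbabilityMeasure_uniformOn finite_univ univ_nonempty

lemma coin_singleton (b : Bool) : coin {b} = 2⁻¹ := by
  rw [coin, uniformOn_univ]
  simp

lemma map_not_coin : coin.map Bool.not = coin := by
  refine Measure.ext_of_singleton fun b => ?_
  rw [Measure.map_apply (measurable_of_countable _) (measurableSet_singleton b)]
  have : Bool.not ⁻¹' {b} = {!b} := by ext c; cases b <;> cases c <;> simp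
  rw [this, coin_singleton, coin_singleton]

/-- Coin tosses indexed by the natural numbers and by the infinite binary sequences. -/
abbrev Tosses : Type := (ℕ ⊕ (ℕ → Bool)) → Bool

/-- The law of independent fair coin tosses. -/
def fairTosses : Measure Tosses := Measure.infinitePi fun _ => coin

instance : IsProbabilityMeasure fairTosses := by unfold fairTosses; infer_instance

/-- The event that the first `n` tosses follow `α`. -/
def cyl (α : ℕ → Bool) (n : ℕ) : Set Tosses := {z | ∀ k < n, z (Sum.inl k) = α k}

lemma measurableSet_cyl (α : ℕ → Bool) (n : ℕ) : MeasurableSet (cyl α n) := by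
  have : cyl α n = ⋂ k, ⋂ (_ : k < n), (fun z : Tosses => z (Sum.inl k)) ⁻¹' {α k} := by
    ext z; simp [cyl]
  rw [this]
  exact .iInter fun k => .iInter fun _ => measurable_pi_apply _ (measurableSet_singleton _)

lemma cyl_anti (α : ℕ → Bool) : Antitone (cyl α) := fun _ _ hmn _ hz k hk => hz k (hk.trans_le hmn)

lemma cyl_congr {α β : ℕ → Bool} {n : ℕ} (h : ∀ k < n, α k = β k) : cyl α n = cyl β n := by
  ext z
  exact forall₂_congr fun k hk => by rw [h k hk]

lemma fairTosses_cyl (α : ℕ → Bool) (n : ℕ) : fairTosses (cyl α n) = 2⁻¹ ^ n := by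
  have : cyl α n = Set.pi ((Finset.range n).map Function.Embedding.inl :
      Finset (ℕ ⊕ (ℕ → Bool))) (fun i => {Sum.elim α (fun _ => true) i}) := by
    ext z; simp [cyl]
  rw [this, fairTosses, Measure.infinitePi_pi _ (fun _ _ => measurableSet_singleton _)]
  simp [coin_singleton]

lemma tendsto_fairTosses_cyl (α : ℕ → Bool) :
    Tendsto (fun n => fairTosses (cyl α n)) atTop (nhds 0) := by
  simp_rw [fairTosses_cyl]
  exact ENNReal.tendsto_pow_atTop_nhds_zero_of_lt_one (by simp)

lemma exists_subset_lt_fairTosses {s : Set Tosses} (hs : MeasurableSet s)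
    (hpos : 0 < fairTosses s) :
    ∃ t ⊆ s, MeasurableSet t ∧ 0 < fairTosses t ∧ fairTosses t < fairTosses s := by
  obtain ⟨n, hn⟩ := ((ENNReal.tendsto_pow_atTop_nhds_zero_of_lt_one
    (r := 2⁻¹) (by simp)).eventually_lt_const hpos).exists
  let extend (β : Fin n → Bool) (k : ℕ) : Bool := if h : k < n then β ⟨k, h⟩ else true
  have hcover : s = ⋃ β : Fin n → Bool, s ∩ cyl (extend β) n := by
    rw [← inter_iUnion, eq_comm, inter_eq_left]
    intro z _
    refine mem_iUnion.2 ⟨fun k => z (Sum.inl k), fun k hk => ?_⟩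
    simp [extend, hk]
  by_contra! hcon
  refine hpos.ne' ?_
  rw [hcover, measure_iUnion_null_iff]
  intro β
  by_contra hβ
  refine absurd (hcon _ inter_subset_left (hs.inter (measurableSet_cyl _ n))
    (pos_iff_ne_zero.2 hβ)) (not_le.2 ?_)
  refine (measure_mono inter_subset_right).trans_lt ?_
  rwa [fairTosses_cyl]

/-- Any probability measure on coin tosses charges some shrinking sequence of cylinders at least as
much as the fair tosses do. -/
lemma exists_forall_le_measure_cyl (Q : Measure Tosses) [IsProbabilityMeasure Q] :
    ∃ α : ℕ → Bool, ∀ n, 2⁻¹ ^ n ≤ Q (cyl α n) := by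
  have step (n : ℕ) (α : ℕ → Bool) (h : 2⁻¹ ^ n ≤ Q (cyl α n)) :
      ∃ b, 2⁻¹ ^ (n + 1) ≤ Q (cyl (Function.update α n b) (n + 1)) := by
    by_contra! hlt
    have hsub : cyl α n ⊆ cyl (Function.update α n true) (n + 1) ∪
        cyl (Function.update α n false) (n + 1) := by
      intro z hz
      have key (b : Bool) (hb : z (Sum.inl n) = b) :
          z ∈ cyl (Function.update α n b) (n + 1) := by
        intro k hk
        rcases Nat.lt_succ_iff_lt_or_eq.1 hk with hk | rfl
        · rw [Function.update_of_ne hk.ne, hz k hk]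
        · simpa using hb
      cases hb : z (Sum.inl n) with
      | true => exact Or.inl (key _ hb)
      | false => exact Or.inr (key _ hb)
    have : (2⁻¹ : ENNReal) ^ n < 2⁻¹ ^ (n + 1) + 2⁻¹ ^ (n + 1) :=
      (h.trans ((measure_mono hsub).trans (measure_union_le _ _))).trans_lt
        (ENNReal.add_lt_add (hlt true) (hlt false))
    rw [pow_succ, ← mul_add, ENNReal.inv_two_add_inv_two, mul_one] at this
    exact this.false
  let β : (n : ℕ) → {α : ℕ → Bool // 2⁻¹ ^ n ≤ Q (cyl α n)} := fun n =>
    Nat.rec ⟨fun _ => true, by simp [cyl]⟩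
      (fun n α => ⟨_, (step n α.1 α.2).choose_spec⟩) n
  have hβ (k n : ℕ) (hk : k < n) : (β n).1 k = (β (k + 1)).1 k := by
    induction n, hk using Nat.le_induction with
    | base => rfl
    | succ n hn ih => rw [← ih]; exact Function.update_of_ne (Nat.ne_of_lt hn) _ _
  refine ⟨fun k => (β (k + 1)).1 k, fun n => ?_⟩
  rw [cyl_congr fun k hk => (hβ k n hk).symm]
  exact (β n).2

/-- Flip the toss with index `j`. -/
def flipAt (j : ℕ ⊕ (ℕ → Bool)) (z : Tosses) : Tosses := by
  classical exact fun i => (if i = j then Bool.not else id) (z i)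

lemma flipAt_self (j : ℕ ⊕ (ℕ → Bool)) (z : Tosses) : flipAt j z j = !z j := by
  simp [flipAt]

lemma flipAt_of_ne {i j : ℕ ⊕ (ℕ → Bool)} (h : i ≠ j) (z : Tosses) : flipAt j z i = z i := by
  simp [flipAt, h]

lemma measurePreserving_flipAt (j : ℕ ⊕ (ℕ → Bool)) :
    MeasurePreserving (flipAt j) fairTosses fairTosses := by
  classical
  refine ⟨measurable_pi_lambda _ fun i =>
    (measurable_of_countable _).comp (measurable_pi_apply i), ?_⟩
  unfold fairTosses flipAt
  rw [Measure.infinitePi_map_pi _ fun i => measurable_of_countable _]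
  congr 1
  funext i
  split_ifs
  · exact map_not_coin
  · exact Measure.map_id

end CoinSpace

section Mixtures

/-- The indicator of the cylinder `cyl α n`, rescaled to have mean one; zero when `n = 0`. -/
def bump (α : ℕ → Bool) (n : ℕ) : Tosses → ℝ :=
  if n = 0 then 0 else (cyl α n).indicator fun _ => 2 ^ n

/-- The bump `bump α n` tagged by the toss with index `α`. -/
def taggedBump (i : (ℕ → Bool) × ℕ) (z : Tosses) : ℝ :=
  (if z (Sum.inr i.1) then 1 else 0) + bump i.1 i.2 z

lemma bump_nonneg (α : ℕ → Bool) (n : ℕ) (z : Tosses) : 0 ≤ bump α n z := by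
  unfold bump
  split_ifs
  · exact le_rfl
  · exact indicator_nonneg (fun _ _ => by positivity) z

lemma bump_le {α : ℕ → Bool} {N : ℕ} {z : Tosses} (hz : z ∉ cyl α N) (n : ℕ) :
    bump α n z ≤ 2 ^ N := by
  unfold bump
  split_ifs
  · simp
  · by_cases hzn : z ∈ cyl α n
    · rw [indicator_of_mem hzn]
      have : n ≤ N := by
        by_contra! h
        exact hz (cyl_anti α h.le hzn)
      gcongr
      norm_num
    · rw [indicator_of_notMem hzn]
      positivity

lemma measurable_bump (α : ℕ → Bool) (n : ℕ) : Measurable (bump α n) := by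
  unfold bump
  split_ifs
  · exact measurable_zero
  · exact measurable_const.indicator (measurableSet_cyl α n)

lemma integrable_bump (α : ℕ → Bool) (n : ℕ) : Integrable (bump α n) fairTosses := by
  unfold bump
  split_ifs
  · exact integrable_zero _ _ _
  · exact (integrable_const _).indicator (measurableSet_cyl α n)

lemma integral_bump_le (α : ℕ → Bool) (n : ℕ) : ∫ z, bump α n z ∂fairTosses ≤ 1 := by
  unfold bump
  split_ifs
  · simp
  · rw [integral_indicator_const _ (measurableSet_cyl α n), Measure.real, fairTosses_cyl]
    simp

lemma measurable_tag (α : ℕ → Bool) :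
    Measurable fun z : Tosses => if z (Sum.inr α) then (1 : ℝ) else 0 :=
  (measurable_of_countable fun b : Bool => if b then (1 : ℝ) else 0).comp (measurable_pi_apply _)

lemma integrable_tag (α : ℕ → Bool) :
    Integrable (fun z : Tosses => if z (Sum.inr α) then (1 : ℝ) else 0) fairTosses :=
  .of_bound (measurable_tag α).aestronglyMeasurable 1 <| .of_forall fun z => by
    split_ifs <;> simp

lemma measurable_taggedBump (i : (ℕ → Bool) × ℕ) : Measurable (taggedBump i) :=
  (measurable_tag i.1).add (measurable_bump i.1 i.2)

lemma integrable_taggedBump (i : (ℕ → Bool) × ℕ) : Integrable (taggedBump i) fairTosses :=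
  (integrable_tag i.1).add (integrable_bump i.1 i.2)

lemma taggedBump_nonneg (i : (ℕ → Bool) × ℕ) (z : Tosses) : 0 ≤ taggedBump i z :=
  add_nonneg (by split_ifs <;> simp) (bump_nonneg _ _ _)

lemma taggedBump_le {i : (ℕ → Bool) × ℕ} {N : ℕ} {z : Tosses} (hz : z ∉ cyl i.1 N) :
    taggedBump i z ≤ 1 + 2 ^ N :=
  add_le_add (by split_ifs <;> simp) (bump_le hz _)

lemma integral_taggedBump_le (i : (ℕ → Bool) × ℕ) : ∫ z, taggedBump i z ∂fairTosses ≤ 2 := by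
  unfold taggedBump
  rw [integral_add (integrable_tag i.1) (integrable_bump i.1 i.2)]
  have h : ∫ z : Tosses, (if z (Sum.inr i.1) then (1 : ℝ) else 0) ∂fairTosses
      ≤ ∫ _, 1 ∂fairTosses :=
    integral_mono (integrable_tag i.1) (integrable_const _) fun z => by
      dsimp only; split_ifs <;> simp
  simp only [integral_const, probReal_univ, smul_eq_mul, mul_one] at h
  linarith [integral_bump_le i.1 i.2]

lemma flipAt_inr_mem_cyl {α β : ℕ → Bool} {n : ℕ} {z : Tosses} :
    flipAt (Sum.inr β) z ∈ cyl α n ↔ z ∈ cyl α n := by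
  simp [cyl, flipAt_of_ne]

lemma bump_flipAt (α β : ℕ → Bool) (n : ℕ) (z : Tosses) :
    bump α n (flipAt (Sum.inr β) z) = bump α n z := by
  unfold bump
  split_ifs
  · rfl
  · by_cases h : z ∈ cyl α n
    · rw [indicator_of_mem h, indicator_of_mem (flipAt_inr_mem_cyl.2 h)]
    · rw [indicator_of_notMem h, indicator_of_notMem (mt flipAt_inr_mem_cyl.1 h)]

lemma taggedBump_sub_flipAt (α : ℕ → Bool) (i : (ℕ → Bool) × ℕ) (z : Tosses) :
    taggedBump i z - taggedBump i (flipAt (Sum.inr α) z) =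
      (if z (Sum.inr α) then 1 else -1) * ({i | i.1 = α} : Set _).indicator 1 i := by
  unfold taggedBump
  rw [bump_flipAt]
  by_cases h : i.1 = α
  · rw [indicator_of_mem (by exact h), h, flipAt_self]
    cases z (Sum.inr α) <;> simp
  · rw [indicator_of_notMem (by exact h), flipAt_of_ne (by simpa using h)]
    simp

variable {ι : Type*}

/-- The finitely supported probability weights on `ι`. -/
def weights (ι : Type*) : Set (ι →₀ ℝ) :=
  {w | (∀ i, 0 ≤ w i) ∧ Finsupp.linearCombination ℝ (fun _ => (1 : ℝ)) w = 1}

lemma convex_weights : Convex ℝ (weights ι) := by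
  rintro w ⟨hw, hw1⟩ v ⟨hv, hv1⟩ a b ha hb hab
  refine ⟨fun i => ?_, ?_⟩
  · simp only [Finsupp.add_apply, Finsupp.smul_apply, smul_eq_mul]
    exact add_nonneg (mul_nonneg ha (hw i)) (mul_nonneg hb (hv i))
  · rw [map_add, map_smul, map_smul, hw1, hv1, smul_eq_mul, smul_eq_mul, mul_one, mul_one, hab]

lemma linearCombination_mono {w : ι →₀ ℝ} (hw : ∀ i, 0 ≤ w i) {g h : ι → ℝ} (hgh : ∀ i, g i ≤ h i) :
    Finsupp.linearCombination ℝ g w ≤ Finsupp.linearCombination ℝ h w :=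
  Finset.sum_le_sum fun i _ => mul_le_mul_of_nonneg_left (hgh i) (hw i)

lemma linearCombination_add' (w : ι →₀ ℝ) (g h : ι → ℝ) :
    Finsupp.linearCombination ℝ (fun i => g i + h i) w =
      Finsupp.linearCombination ℝ g w + Finsupp.linearCombination ℝ h w := by
  simp [Finsupp.linearCombination_apply, Finsupp.sum, mul_add, Finset.sum_add_distrib]

lemma linearCombination_const_mul (w : ι →₀ ℝ) (c : ℝ) (g : ι → ℝ) :
    Finsupp.linearCombination ℝ (fun i => c * g i) w =
      c * Finsupp.linearCombination ℝ g w := by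
  simp [Finsupp.linearCombination_apply, Finsupp.sum, Finset.mul_sum, mul_left_comm]

lemma linearCombination_pi_apply {β : Type*} (w : ι →₀ ℝ) (g : ι → β → ℝ) (z : β) :
    Finsupp.linearCombination ℝ g w z = Finsupp.linearCombination ℝ (fun i => g i z) w := by
  simp [Finsupp.linearCombination_apply, Finsupp.sum]

lemma integrable_linearCombination {P : Measure Ω} (w : ι →₀ ℝ) {g : ι → Ω → ℝ}
    (hg : ∀ i, Integrable (g i) P) :
    Integrable (fun z => Finsupp.linearCombination ℝ (fun i => g i z) w) P :=
  integrable_finsetSum _ fun i _ => (hg i).const_mul (w i)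

lemma integral_linearCombination {P : Measure Ω} (w : ι →₀ ℝ) {g : ι → Ω → ℝ}
    (hg : ∀ i, Integrable (g i) P) :
    ∫ z, Finsupp.linearCombination ℝ (fun i => g i z) w ∂P =
      Finsupp.linearCombination ℝ (fun i => ∫ z, g i z ∂P) w := by
  simp only [Finsupp.linearCombination_apply, Finsupp.sum, smul_eq_mul]
  rw [integral_finsetSum _ fun i _ => (hg i).const_mul (w i)]
  simp_rw [integral_const_mul]

lemma measurable_linearCombination (w : ι →₀ ℝ) {g : ι → Ω → ℝ} (hg : ∀ i, Measurable (g i)) :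
    Measurable (fun z => Finsupp.linearCombination ℝ (fun i => g i z) w) :=
  Finset.measurable_fun_sum _ fun i _ => (hg i).const_mul (w i)

lemma linearCombination_nonneg {w : ι →₀ ℝ} (hw : w ∈ weights ι) {g : ι → ℝ}
    (hg : ∀ i, 0 ≤ g i) : 0 ≤ Finsupp.linearCombination ℝ g w :=
  Finset.sum_nonneg fun i _ => mul_nonneg (hw.1 i) (hg i)

lemma linearCombination_const {w : ι →₀ ℝ} (hw : w ∈ weights ι) (c : ℝ) :
    Finsupp.linearCombination ℝ (fun _ => c) w = c := by
  simpa [hw.2] using linearCombination_const_mul w c fun _ => 1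

end Mixtures

section MixtureSet

/-- The mixture of the tagged bumps with weights `w`. -/
def mixture (w : ((ℕ → Bool) × ℕ) →₀ ℝ) (z : Tosses) : ℝ :=
  Finsupp.linearCombination ℝ (fun i => taggedBump i z) w

/-- The set of all mixtures of tagged bumps. -/
def mixtures : Set (Tosses → ℝ) := mixture '' weights ((ℕ → Bool) × ℕ)

/-- The total mass that `w` puts on the indices whose first coordinate lies in `S`. -/
def mass (S : Set (ℕ → Bool)) (w : ((ℕ → Bool) × ℕ) →₀ ℝ) : ℝ :=
  Finsupp.linearCombination ℝ ((Prod.fst ⁻¹' S).indicator 1) w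

lemma mixture_eq_linearCombination :
    mixture = Finsupp.linearCombination ℝ taggedBump := by
  ext w z
  exact (linearCombination_pi_apply w taggedBump z).symm

lemma convex_mixtures : Convex ℝ mixtures := by
  rw [mixtures, mixture_eq_linearCombination]
  exact convex_weights.linear_image _

lemma measurable_mixture (w : ((ℕ → Bool) × ℕ) →₀ ℝ) : Measurable (mixture w) :=
  measurable_linearCombination w measurable_taggedBump

lemma integrable_mixture (w : ((ℕ → Bool) × ℕ) →₀ ℝ) : Integrable (mixture w) fairTosses :=
  integrable_linearCombination w integrable_taggedBump

lemma mixture_nonneg {w : ((ℕ → Bool) × ℕ) →₀ ℝ} (hw : w ∈ weights _) (z : Tosses) :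
    0 ≤ mixture w z :=
  linearCombination_nonneg hw fun i => taggedBump_nonneg i z

lemma integral_mixture_le {w : ((ℕ → Bool) × ℕ) →₀ ℝ} (hw : w ∈ weights _) :
    ∫ z, mixture w z ∂fairTosses ≤ 2 := by
  unfold mixture
  rw [integral_linearCombination w integrable_taggedBump, ← linearCombination_const hw 2]
  exact linearCombination_mono hw.1 integral_taggedBump_le

lemma mixture_sub_flipAt (w : ((ℕ → Bool) × ℕ) →₀ ℝ) (α : ℕ → Bool) (z : Tosses) :
    mixture w z - mixture w (flipAt (Sum.inr α) z) =
      (if z (Sum.inr α) then 1 else -1) * mass {α} w := by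
  rw [sub_eq_iff_eq_add, mass, ← linearCombination_const_mul]
  unfold mixture
  rw [← linearCombination_add']
  congr 2
  funext i
  exact sub_eq_iff_eq_add.1 (taggedBump_sub_flipAt α i z)

lemma tendsto_mass_singleton {w : ℕ → ((ℕ → Bool) × ℕ) →₀ ℝ} {v : ((ℕ → Bool) × ℕ) →₀ ℝ}
    (h : TendstoInMeasure fairTosses (fun n => mixture (w n)) atTop (mixture v)) (α : ℕ → Bool) :
    Tendsto (fun n => mass {α} (w n)) atTop (nhds (mass {α} v)) := by
  rw [Metric.tendsto_nhds]
  intro ε hε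
  have hlt : (0 : ENNReal) < 2⁻¹ := by simp
  filter_upwards [((tendstoInMeasure_iff_norm.1 h) (ε / 2) (half_pos hε)).eventually_lt_const hlt]
    with n hn
  by_contra! hge
  set A : Set Tosses := {z | ε / 2 ≤ ‖mixture (w n) z - mixture v z‖}
  have hA : MeasurableSet A := measurableSet_le measurable_const
    ((measurable_mixture (w n)).sub (measurable_mixture v)).norm
  have hcover : (univ : Set Tosses) ⊆ A ∪ flipAt (Sum.inr α) ⁻¹' A := by
    intro z _
    by_contra hz
    simp only [mem_union, not_or] at hz
    obtain ⟨h₁, h₂⟩ := hz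
    replace h₁ : |mixture (w n) z - mixture v z| < ε / 2 := not_le.1 h₁
    replace h₂ : |mixture (w n) (flipAt (Sum.inr α) z) - mixture v (flipAt (Sum.inr α) z)|
      < ε / 2 := not_le.1 h₂
    have hw := mixture_sub_flipAt (w n) α z
    have hv := mixture_sub_flipAt v α z
    rw [Real.dist_eq, le_abs] at hge
    rw [abs_lt] at h₁ h₂
    split_ifs at hw hv <;> rcases hge with hge | hge <;> linarith
  have := (measure_mono hcover).trans (measure_union_le (μ := fairTosses) _ _)
  rw [measure_univ, (measurePreserving_flipAt _).measure_preimage hA.nullMeasurableSet] at this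
  exact (this.trans_lt (ENNReal.add_lt_add hn hn)).ne (ENNReal.inv_two_add_inv_two).symm

lemma mass_finset (S : Finset (ℕ → Bool)) (w : ((ℕ → Bool) × ℕ) →₀ ℝ) :
    mass S w = ∑ α ∈ S, mass {α} w := by
  classical
  simp only [mass, Finsupp.linearCombination_apply, Finsupp.sum]
  rw [Finset.sum_comm]
  refine Finset.sum_congr rfl fun i _ => ?_
  simp [indicator_apply, Finset.sum_ite_eq]

/-- The part of a mixture carried by the tags outside `S` has small mean when the mass outside `S`
is small. -/
lemma lintegral_enorm_mixture_outside_le {w : ((ℕ → Bool) × ℕ) →₀ ℝ} (hw : w ∈ weights _)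
    (S : Set (ℕ → Bool)) :
    ∫⁻ z, ‖Finsupp.linearCombination ℝ
      (fun i => (Prod.fst ⁻¹' S)ᶜ.indicator (fun i => taggedBump i z) i) w‖ₑ ∂fairTosses ≤
      ENNReal.ofReal (2 * (1 - mass S w)) := by
  have hnn (i : (ℕ → Bool) × ℕ) (z : Tosses) :
      0 ≤ (Prod.fst ⁻¹' S)ᶜ.indicator (fun i => taggedBump i z) i :=
    indicator_nonneg (fun i _ => taggedBump_nonneg i z) i
  have hint (i : (ℕ → Bool) × ℕ) : Integrable
      (fun z => (Prod.fst ⁻¹' S)ᶜ.indicator (fun i => taggedBump i z) i) fairTosses := by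
    by_cases hi : i ∈ (Prod.fst ⁻¹' S)ᶜ
    · simpa only [indicator_of_mem hi] using integrable_taggedBump i
    · simp only [indicator_of_notMem hi]
      exact integrable_zero _ _ _
  rw [← ofReal_integral_norm_eq_lintegral_enorm (integrable_linearCombination w hint)]
  refine ENNReal.ofReal_le_ofReal ?_
  simp_rw [Real.norm_of_nonneg (linearCombination_nonneg hw fun i => hnn i _)]
  rw [integral_linearCombination w hint]
  have hsplit : 2 * (1 - mass S w) = Finsupp.linearCombination ℝ
      (fun i => 2 * (Prod.fst ⁻¹' S)ᶜ.indicator 1 i) w := by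
    have := linearCombination_add' w ((Prod.fst ⁻¹' S)ᶜ.indicator 1)
      ((Prod.fst ⁻¹' S).indicator 1)
    simp_rw [indicator_compl_add_self_apply, Pi.one_apply, hw.2] at this
    rw [linearCombination_const_mul, this, mass, add_sub_cancel_right]
  rw [hsplit]
  refine linearCombination_mono hw.1 fun i => ?_
  by_cases hi : i ∈ (Prod.fst ⁻¹' S)ᶜ
  · simpa only [indicator_of_mem hi, Pi.one_apply, mul_one] using integral_taggedBump_le i
  · simp only [indicator_of_notMem hi, integral_zero, mul_zero, le_refl]

/-- Away from the cylinders `cyl α N`, `α ∈ S`, the part of a mixture carried by the tags in `S` is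
bounded. -/
lemma linearCombination_indicator_taggedBump_mem_Icc {w : ((ℕ → Bool) × ℕ) →₀ ℝ}
    (hw : w ∈ weights _) {S : Set (ℕ → Bool)} {N : ℕ} {z : Tosses}
    (hz : ∀ α ∈ S, z ∉ cyl α N) :
    Finsupp.linearCombination ℝ
      (fun i => (Prod.fst ⁻¹' S).indicator (fun i => taggedBump i z) i) w ∈
      Icc 0 (1 + 2 ^ N : ℝ) := by
  refine ⟨linearCombination_nonneg hw fun i =>
    indicator_nonneg (fun i _ => taggedBump_nonneg i z) i, ?_⟩
  rw [← linearCombination_const hw (1 + 2 ^ N)]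
  refine linearCombination_mono hw.1 fun i => ?_
  by_cases hi : i ∈ Prod.fst ⁻¹' S
  · rw [indicator_of_mem hi]
    exact taggedBump_le (hz _ hi)
  · rw [indicator_of_notMem hi]
    positivity

lemma tendsto_setLIntegral_enorm_mixture_sub {w : ℕ → ((ℕ → Bool) × ℕ) →₀ ℝ}
    {v : ((ℕ → Bool) × ℕ) →₀ ℝ} (hw : ∀ n, w n ∈ weights _) (hv : v ∈ weights _)
    (h : TendstoInMeasure fairTosses (fun n => mixture (w n)) atTop (mixture v))
    (S : Finset (ℕ → Bool)) (hS : ∀ i ∈ v.support, i.1 ∈ S) (N : ℕ) :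
    Tendsto (fun n => ∫⁻ z in (⋃ α ∈ S, cyl α N)ᶜ, ‖mixture (w n) z - mixture v z‖ₑ ∂fairTosses)
      atTop (nhds 0) := by
  have hB : MeasurableSet (⋃ α ∈ S, cyl α N)ᶜ :=
    (S.measurableSet_biUnion fun α _ => measurableSet_cyl α N).compl
  set B := (⋃ α ∈ S, cyl α N)ᶜ
  let inner (u : ((ℕ → Bool) × ℕ) →₀ ℝ) (z : Tosses) : ℝ := Finsupp.linearCombination ℝ
    (fun i => (Prod.fst ⁻¹' (S : Set (ℕ → Bool))).indicator (fun i => taggedBump i z) i) u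
  let outer (u : ((ℕ → Bool) × ℕ) →₀ ℝ) (z : Tosses) : ℝ := Finsupp.linearCombination ℝ
    (fun i => (Prod.fst ⁻¹' (S : Set (ℕ → Bool)))ᶜ.indicator (fun i => taggedBump i z) i) u
  have hsplit (u : ((ℕ → Bool) × ℕ) →₀ ℝ) (z : Tosses) : mixture u z = inner u z + outer u z := by
    simp only [inner, outer]
    rw [← linearCombination_add']
    simp_rw [indicator_self_add_compl_apply]
    rfl
  have hv_inner (z : Tosses) : mixture v z = inner v z :=
    Finset.sum_congr rfl fun i hi => by
      dsimp only
      rw [indicator_of_mem (by exact hS i hi)]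
  have hmass_v : mass S v = 1 := by
    rw [← hv.2]
    refine Finset.sum_congr rfl fun i hi => ?_
    dsimp only
    rw [indicator_of_mem (by exact hS i hi), Pi.one_apply]
  have hout : Tendsto (fun n => ENNReal.ofReal (2 * (1 - mass S (w n)))) atTop (nhds 0) := by
    have : Tendsto (fun n => mass S (w n)) atTop (nhds (mass S v)) := by
      simp_rw [mass_finset]
      exact tendsto_finsetSum _ fun α _ => tendsto_mass_singleton h α
    simpa [hmass_v] using ENNReal.tendsto_ofReal ((this.const_sub 1).const_mul 2)
  have hinner (z : Tosses) (hz : z ∈ B) (u : ((ℕ → Bool) × ℕ) →₀ ℝ) (hu : u ∈ weights _) :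
      inner u z ∈ Icc 0 (1 + 2 ^ N : ℝ) :=
    linearCombination_indicator_taggedBump_mem_Icc hu fun α hα hzα =>
      hz (mem_biUnion hα hzα)
  set C : ENNReal := ENNReal.ofReal (1 + 2 ^ N)
  have hbound (δ : ENNReal) (n : ℕ) :
      ∫⁻ z in B, ‖mixture (w n) z - mixture v z‖ₑ ∂fairTosses ≤
        δ + C * fairTosses {z | δ ≤ ‖mixture (w n) z - mixture v z‖ₑ} +
          ENNReal.ofReal (2 * (1 - mass S (w n))) := by
    set D : Set Tosses := {z | δ ≤ ‖mixture (w n) z - mixture v z‖ₑ}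
    have hD : MeasurableSet D := measurableSet_le measurable_const
      ((measurable_mixture (w n)).sub (measurable_mixture v)).enorm
    calc ∫⁻ z in B, ‖mixture (w n) z - mixture v z‖ₑ ∂fairTosses
        ≤ ∫⁻ z in B, (δ + D.indicator (fun _ => C) z) + ‖outer (w n) z‖ₑ ∂fairTosses := by
          refine setLIntegral_mono' hB fun z hz => ?_
          by_cases hzD : z ∈ D
          · rw [indicator_of_mem hzD]
            have hle : ‖mixture (w n) z - mixture v z‖ₑ ≤ C + ‖outer (w n) z‖ₑ := by
              rw [hv_inner, hsplit, add_sub_right_comm]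
              refine (enorm_add_le _ _).trans (add_le_add_left ?_ _)
              rw [Real.enorm_eq_ofReal_abs]
              refine ENNReal.ofReal_le_ofReal (abs_le.2 ?_)
              obtain ⟨h₁, h₂⟩ := hinner z hz _ (hw n)
              obtain ⟨h₃, h₄⟩ := hinner z hz _ hv
              constructor <;> linarith
            rw [add_assoc]
            exact hle.trans le_add_self
          · rw [add_assoc]
            exact (not_le.1 hzD).le.trans le_self_add
      _ ≤ ∫⁻ z, (δ + D.indicator (fun _ => C) z) + ‖outer (w n) z‖ₑ ∂fairTosses :=
          setLIntegral_le_lintegral _ _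
      _ = δ + C * fairTosses D + ∫⁻ z, ‖outer (w n) z‖ₑ ∂fairTosses := by
          have hmeas : Measurable fun z => δ + D.indicator (fun _ => C) z :=
            measurable_const.add (measurable_const.indicator hD)
          rw [lintegral_add_left hmeas, lintegral_add_left measurable_const, lintegral_indicator_const hD]
          simp
      _ ≤ _ := add_le_add_right (lintegral_enorm_mixture_outside_le (hw n) S) _
  rw [ENNReal.tendsto_nhds_zero]
  intro ε hε
  obtain ⟨δ, hδ, hδε⟩ := exists_between hε
  have hlim := ((ENNReal.Tendsto.const_mul (a := C)
    (tendstoInMeasure_iff_enorm.1 h δ hδ hδε.ne_top) (Or.inr ENNReal.ofReal_ne_top)).const_add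
      δ).add hout
  rw [mul_zero, add_zero, add_zero] at hlim
  filter_upwards [hlim.eventually_lt_const hδε] with n hn
  exact (hbound δ n).trans hn.le

lemma locConvexAt_mixtures {X : Tosses → ℝ} (hX : X ∈ mixtures) :
    LocConvexAt fairTosses mixtures X := by
  classical
  intro Xs hXs hlim W hW
  obtain ⟨v, hv, rfl⟩ := hX
  choose w hw hwX using hXs
  obtain rfl : (fun n => mixture (w n)) = Xs := funext hwX
  set S := v.support.image Prod.fst
  refine hW.tendstoInMeasure (fun n => measurable_mixture (w n)) (measurable_mixture v)
    fun ε hε => ?_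
  have hsum : Tendsto (fun N => ∑ α ∈ S, fairTosses (cyl α N)) atTop (nhds 0) := by
    simpa using tendsto_finsetSum S fun α _ => tendsto_fairTosses_cyl α
  obtain ⟨N, hN⟩ := (hsum.eventually_lt_const hε).exists
  refine ⟨(⋃ α ∈ S, cyl α N)ᶜ,
    (S.measurableSet_biUnion fun α _ => measurableSet_cyl α N).compl, ?_, ?_⟩
  · rw [compl_compl]
    exact (measure_biUnion_finset_le S _).trans hN.le
  · exact tendsto_setLIntegral_enorm_mixture_sub hw hv hlim S
      (fun i hi => Finset.mem_image_of_mem _ hi) N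

lemma taggedBump_mem_mixtures (i : (ℕ → Bool) × ℕ) : taggedBump i ∈ mixtures := by
  classical
  refine ⟨Finsupp.single i 1, ⟨fun j => ?_, by simp⟩, by ext z; simp [mixture]⟩
  rw [Finsupp.single_apply]
  split_ifs <;> simp

lemma taggedBump_succ_sub_zero (α : ℕ → Bool) (n : ℕ) (z : Tosses) :
    taggedBump (α, n + 1) z - taggedBump (α, 0) z =
      (cyl α (n + 1)).indicator (fun _ => 2 ^ (n + 1)) z := by
  simp [taggedBump, bump]

lemma tendstoInMeasure_taggedBump (α : ℕ → Bool) :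
    TendstoInMeasure fairTosses (fun n => taggedBump (α, n + 1)) atTop (taggedBump (α, 0)) := by
  rw [tendstoInMeasure_iff_enorm]
  intro ε hε _
  refine tendsto_of_tendsto_of_tendsto_of_le_of_le tendsto_const_nhds
    ((tendsto_fairTosses_cyl α).comp (tendsto_add_atTop_nat 1)) (fun _ => zero_le)
    fun n => measure_mono fun z hz => ?_
  by_contra hzc
  rw [mem_ofPred_eq, taggedBump_succ_sub_zero, indicator_of_notMem hzc, enorm_zero] at hz
  exact hz.not_gt hε

lemma not_topAgree_mixtures (Q : Measure Tosses) [IsProbabilityMeasure Q] :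
    ¬ TopAgree fairTosses Q mixtures := by
  intro hagree
  obtain ⟨α, hα⟩ := exists_forall_le_measure_cyl Q
  have hlim := (hagree _ _ (fun n => taggedBump_mem_mixtures (α, n + 1))
    (taggedBump_mem_mixtures (α, 0))).1 (tendstoInMeasure_taggedBump α)
  obtain ⟨n, hn⟩ := (hlim.eventually_lt_const zero_lt_one).exists
  refine hn.not_ge ?_
  have hint (z : Tosses) : ENNReal.ofReal |taggedBump (α, n + 1) z - taggedBump (α, 0) z| =
      (cyl α (n + 1)).indicator (fun _ => 2 ^ (n + 1)) z := by
    rw [taggedBump_succ_sub_zero]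
    by_cases hz : z ∈ cyl α (n + 1)
    · simp [hz, abs_of_pos, ENNReal.ofReal_pow]
    · simp [hz]
  simp_rw [hint]
  rw [lintegral_indicator_const (measurableSet_cyl α (n + 1))]
  calc (1 : ENNReal) = 2 ^ (n + 1) * 2⁻¹ ^ (n + 1) := by
        rw [← mul_pow, ENNReal.mul_inv_cancel two_ne_zero ENNReal.ofNat_ne_top, one_pow]
    _ ≤ 2 ^ (n + 1) * Q (cyl α (n + 1)) := by gcongr; exact hα _

end MixtureSet

/-- Theorem 1.5 (Example B): there exist a nonatomic probability space and a convex
`L¹`-bounded set of nonnegative integrable random variables on which the `L⁰(P)`-topology is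
locally convex, while no equivalent probability measure `Q` makes the `L⁰(Q)`- and
`L¹(Q)`-topologies agree on it. -/
theorem statement19 :
    ∃ (Ω : Type) (m : MeasurableSpace Ω) (P : Measure Ω),
      IsProbabilityMeasure P ∧
      (∀ s : Set Ω, MeasurableSet s → 0 < P s →
        ∃ t ⊆ s, MeasurableSet t ∧ 0 < P t ∧ P t < P s) ∧
      ∃ K : Set (Ω → ℝ),
        Convex ℝ K ∧ (∀ X ∈ K, Integrable X P) ∧
        (∀ X ∈ K, (0 : Ω → ℝ) ≤ᵐ[P] X) ∧
        (∃ C : ℝ, ∀ X ∈ K, (∫ ω, |X ω| ∂P) ≤ C) ∧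
        (∀ X ∈ K, LocConvexAt P K X) ∧
        ¬ (∃ Q : Measure Ω, EquivProb P Q ∧ TopAgree P Q K) := by
  refine ⟨Tosses, inferInstance, fairTosses, inferInstance,
    fun s hs hpos => exists_subset_lt_fairTosses hs hpos, mixtures, convex_mixtures, ?_, ?_,
    ⟨2, ?_⟩, fun X hX => locConvexAt_mixtures hX, ?_⟩
  · rintro _ ⟨w, _, rfl⟩
    exact integrable_mixture w
  · rintro _ ⟨w, hw, rfl⟩
    exact .of_forall (mixture_nonneg hw)
  · rintro _ ⟨w, hw, rfl⟩
    simp_rw [abs_of_nonneg (mixture_nonneg hw _)]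
    exact integral_mixture_le hw
  · rintro ⟨Q, ⟨hQ, _, _⟩, hagree⟩
    exact not_topAgree_mixtures Q hagree

end Paper
end
end
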